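/- arXiv:2409.17375 — 2 statements merged into one kernel-verified Lean document; each statement's English description precedes it below -/
import Mathlib

section
/- (Kim–Koberda.) If there exists an injective group homomorphism from A(P_4) into a right-angled Artin group A(Γ), then the finite simplicial graph Γ contains P_4 as an induced subgraph. -/
/-- Relations of the right-angled Artin group of a simplicial graph: commutators of adjacent vertices. -/
def raagRels {V : Type*} (G : SimpleGraph V) : Set (FreeGroup V) :=
  {r | ∃ u v : V, G.Adj u v ∧
    r = FreeGroup.of u * FreeGroup.of v * (FreeGroup.of u)⁻¹ * (FreeGroup.of v)⁻¹}

/-- The right-angled Artin group of a simplicial graph. -/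
abbrev RAAG {V : Type*} (G : SimpleGraph V) := PresentedGroup (raagRels G)

/-- The simplicial graph `Γ` contains the path `P₄` on four vertices as an induced
subgraph. -/
def HasInducedP4 {V : Type*} (Γ : SimpleGraph V) : Prop :=
  ∃ φ : Fin 4 → V, Function.Injective φ ∧
    ∀ i j, Γ.Adj (φ i) (φ j) ↔ (SimpleGraph.pathGraph 4).Adj i j


set_option linter.unusedSectionVars false
namespace KK
open Monoid

section words
variable {ι : Type*} {G : ι → Type*} [∀ i, Group (G i)]

/-- Reduced words. -/
def Red (l : List (Σ i, G i)) : Prop :=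
  (∀ p ∈ l, p.2 ≠ 1) ∧ l.IsChain (fun p q => p.1 ≠ q.1)

/-- Evaluation of words. -/
def ev (l : List (Σ i, G i)) : CoprodI G := (l.map fun p => CoprodI.of p.2).prod

/-- Index of the first letter. -/
def hd (l : List (Σ i, G i)) : Option ι := l.head?.map Sigma.fst

/-- Index of the last letter. -/
def la (l : List (Σ i, G i)) : Option ι := l.getLast?.map Sigma.fst

@[simp] lemma ev_nil : ev ([] : List (Σ i, G i)) = 1 := rfl
@[simp] lemma ev_cons (p : Σ i, G i) (l : List (Σ i, G i)) :
    ev (p :: l) = CoprodI.of p.2 * ev l := by simp [ev]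
@[simp] lemma ev_append (l m : List (Σ i, G i)) : ev (l ++ m) = ev l * ev m := by simp [ev]
@[simp] lemma hd_cons (p : Σ i, G i) (l : List (Σ i, G i)) : hd (p :: l) = some p.1 := by simp [hd]
@[simp] lemma hd_nil : hd ([] : List (Σ i, G i)) = none := rfl
@[simp] lemma la_nil : la ([] : List (Σ i, G i)) = none := rfl
@[simp] lemma la_concat (p : Σ i, G i) (l : List (Σ i, G i)) : la (l ++ [p]) = some p.1 := by
  simp [la]
lemma hd_append {l : List (Σ i, G i)} (m : List (Σ i, G i)) (h : l ≠ []) :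
    hd (l ++ m) = hd l := by
  cases l <;> simp_all
lemma la_append (l : List (Σ i, G i)) {m : List (Σ i, G i)} (h : m ≠ []) :
    la (l ++ m) = la m := by
  simp [la, List.getLast?_append_of_ne_nil _ h]
lemma ne_nil_of_hd {l : List (Σ i, G i)} {i} (h : hd l = some i) : l ≠ [] := by
  rintro rfl; simp at h
lemma ne_nil_of_la {l : List (Σ i, G i)} {i} (h : la l = some i) : l ≠ [] := by
  rintro rfl; simp at h
lemma hd_eq {l : List (Σ i, G i)} {i} (h : hd l = some i) : ∃ (g : G i) (t : _), l = ⟨i, g⟩ :: t := by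
  rcases l with _ | ⟨⟨j, g⟩, t⟩
  · simp at h
  · simp at h; subst h; exact ⟨g, t, rfl⟩
lemma la_eq {l : List (Σ i, G i)} {i} (h : la l = some i) :
    ∃ (g : G i) (t : _), l = t ++ [⟨i, g⟩] := by
  rcases l.eq_nil_or_concat' with rfl | ⟨t, ⟨j, g⟩, rfl⟩
  · simp at h
  · simp at h; subst h; exact ⟨g, t, rfl⟩

lemma red_nil : Red ([] : List (Σ i, G i)) := by simp [Red]

lemma red_append {l m : List (Σ i, G i)} :
    Red (l ++ m) ↔ Red l ∧ Red m ∧ ∀ i, la l = some i → hd m ≠ some i := by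
  simp only [Red, List.isChain_append, List.mem_append, la, hd]
  constructor
  · rintro ⟨h1, h2, h3, h4⟩
    refine ⟨⟨fun p hp => h1 p (Or.inl hp), h2⟩, ⟨fun p hp => h1 p (Or.inr hp), h3⟩, ?_⟩
    intro i hi hj
    simp only [Option.map_eq_some_iff] at hi hj
    obtain ⟨a, ha, rfl⟩ := hi
    obtain ⟨b, hb, hab⟩ := hj
    exact h4 a ha b hb hab.symm
  · rintro ⟨⟨h1, h2⟩, ⟨h3, h4⟩, h5⟩
    refine ⟨fun p hp => hp.elim (h1 p) (h3 p), h2, h4, ?_⟩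
    intro x hx y hy hxy
    refine h5 x.1 ?_ ?_
    · rw [Option.mem_def.1 hx]; rfl
    · rw [Option.mem_def.1 hy, hxy]; rfl

lemma red_single {i} {g : G i} (h : g ≠ 1) : Red ([⟨i, g⟩] : List (Σ i, G i)) := by
  simp [Red, h]

lemma red_single_iff {i} {g : G i} : Red ([⟨i, g⟩] : List (Σ i, G i)) ↔ g ≠ 1 := by
  simp [Red]

lemma red_cons {i} {g : G i} {m : List (Σ i, G i)} :
    Red (⟨i, g⟩ :: m) ↔ g ≠ 1 ∧ Red m ∧ hd m ≠ some i := by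
  rw [← List.singleton_append, red_append, red_single_iff]
  simp [la]

lemma red_concat {i} {g : G i} {m : List (Σ i, G i)} :
    Red (m ++ [⟨i, g⟩]) ↔ Red m ∧ g ≠ 1 ∧ la m ≠ some i := by
  rw [red_append, red_single_iff]
  simp only [hd_cons]
  constructor
  · rintro ⟨a, b, c⟩
    exact ⟨a, b, fun h => c i h rfl⟩
  · rintro ⟨a, b, c⟩
    refine ⟨a, b, fun j hj h => c ?_⟩
    rw [hj, h]

lemma ev_inj {l m : List (Σ i, G i)} (hl : Red l) (hm : Red m) (h : ev l = ev m) : l = m := by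
  classical
  have : (⟨l, hl.1, hl.2⟩ : CoprodI.Word G) = ⟨m, hm.1, hm.2⟩ :=
    CoprodI.Word.equiv.symm.injective h
  exact congrArg CoprodI.Word.toList this

lemma exists_red (x : CoprodI G) : ∃ l : List (Σ i, G i), Red l ∧ ev l = x := by
  classical
  refine ⟨(CoprodI.Word.equiv x).toList, ⟨(CoprodI.Word.equiv x).2, (CoprodI.Word.equiv x).3⟩, ?_⟩
  exact CoprodI.Word.equiv.symm_apply_apply x

/-- Inverse of a word. -/
def iv (l : List (Σ i, G i)) : List (Σ i, G i) := (l.map fun p => ⟨p.1, p.2⁻¹⟩).reverse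

lemma iv_cons (p : Σ i, G i) (l : List (Σ i, G i)) : iv (p :: l) = iv l ++ [⟨p.1, p.2⁻¹⟩] := by
  simp [iv]

lemma ev_iv (l : List (Σ i, G i)) : ev (iv l) = (ev l)⁻¹ := by
  induction l with
  | nil => simp [iv]
  | cons p l ih => simp [iv_cons, ih]

lemma length_iv (l : List (Σ i, G i)) : (iv l).length = l.length := by simp [iv]

lemma la_iv (l : List (Σ i, G i)) : la (iv l) = hd l := by
  cases l <;> simp [iv, la, hd]

lemma hd_iv (l : List (Σ i, G i)) : hd (iv l) = la l := by
  rcases l.eq_nil_or_concat' with rfl | ⟨t, p, rfl⟩ <;> simp [iv, hd, la]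

lemma red_iv {l : List (Σ i, G i)} (h : Red l) : Red (iv l) := by
  induction l with
  | nil => exact h
  | cons p l ih =>
    obtain ⟨i, g⟩ := p
    rw [red_cons] at h
    rw [iv_cons, red_concat, la_iv]
    exact ⟨ih h.2.1, by simpa using h.1, h.2.2⟩

lemma letter_mul {i} {g : G i} (hg : g ≠ 1) {m : List (Σ i, G i)} (hm : Red m) :
    ∃ m', Red m' ∧ ev m' = CoprodI.of g * ev m ∧ (hd m' = some i ∨ m'.length < m.length) := by
  by_cases h : hd m = some i
  · obtain ⟨k, t, rfl⟩ := hd_eq h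
    rw [red_cons] at hm
    by_cases hgk : g * k = 1
    · refine ⟨t, hm.2.1, ?_, Or.inr (by simp)⟩
      rw [ev_cons, ← mul_assoc, ← map_mul, hgk]; simp
    · refine ⟨⟨i, g * k⟩ :: t, red_cons.2 ⟨hgk, hm.2⟩, ?_, Or.inl (by simp)⟩
      simp [mul_assoc]
  · exact ⟨⟨i, g⟩ :: m, red_cons.2 ⟨hg, hm, h⟩, by simp, Or.inl (by simp)⟩

lemma head_mul {i} {l : List (Σ i, G i)} (hl : Red l) (hi : hd l = some i)
    {m : List (Σ i, G i)} (hm : Red m) :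
    ∃ m', Red m' ∧ ev m' = ev l * ev m ∧ (hd m' = some i ∨ m'.length < m.length) := by
  induction l generalizing i with
  | nil => simp at hi
  | cons p l ih =>
    obtain ⟨j, g⟩ := p
    simp at hi; subst hi
    rw [red_cons] at hl
    obtain ⟨hg, hl, hj⟩ := hl
    rcases hk : hd l with _ | k
    · have : l = [] := by
        rcases l with _ | _
        · rfl
        · simp at hk
      subst this
      simpa using letter_mul hg hm
    · obtain ⟨m', h1, h2, h3⟩ := ih hl hk
      by_cases hh : hd m' = some j
      · have h4 : m'.length < m.length := by
          refine h3.resolve_left fun h5 => hj ?_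
          rw [hk, ← h5, hh]
        obtain ⟨m'', a, b, c⟩ := letter_mul hg h1
        exact ⟨m'', a, by rw [b, h2]; simp [mul_assoc], c.imp_right (·.trans h4)⟩
      · exact ⟨⟨j, g⟩ :: m', red_cons.2 ⟨hg, h1, hh⟩, by simp [h2, mul_assoc], Or.inl (by simp)⟩

lemma last_mul {i} {l : List (Σ i, G i)} (hl : Red l) (hi : la l = some i)
    {m : List (Σ i, G i)} (hm : Red m) :
    ∃ m', Red m' ∧ ev m' = ev m * ev l ∧ (la m' = some i ∨ m'.length < m.length) := by
  obtain ⟨m', a, b, c⟩ := head_mul (red_iv hl) ((hd_iv l).trans hi) (red_iv hm)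
  refine ⟨iv m', red_iv a, ?_, ?_⟩
  · rw [ev_iv, b, ev_iv, ev_iv]; simp
  · rwa [la_iv, length_iv, ← length_iv m]

lemma exists_pow_head {i} {l : List (Σ i, G i)} (hl : Red l) (hi : hd l = some i) (n : ℕ)
    {m : List (Σ i, G i)} (hm : Red m) (hn : m.length ≤ n) :
    ∃ (k : ℕ) (m' : _), Red m' ∧ ev m' = ev l ^ k * ev m ∧ hd m' = some i := by
  induction n generalizing m with
  | zero =>
    have : m = [] := by simpa using hn
    subst this
    exact ⟨1, l, hl, by simp, hi⟩
  | succ n ih =>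
    obtain ⟨m', a, b, c⟩ := head_mul hl hi hm
    rcases c with c | c
    · exact ⟨1, m', a, by simpa using b, c⟩
    · obtain ⟨k, m'', a', b', c'⟩ := ih a (by omega)
      exact ⟨k + 1, m'', a', by rw [b', b, pow_succ, mul_assoc], c'⟩

lemma exists_pow_last {i} {l : List (Σ i, G i)} (hl : Red l) (hi : la l = some i)
    {m : List (Σ i, G i)} (hm : Red m) :
    ∃ (k : ℕ) (m' : _), Red m' ∧ ev m' = ev m * ev l ^ k ∧ la m' = some i := by
  obtain ⟨k, m', a, b, c⟩ :=
    exists_pow_head (red_iv hl) ((hd_iv l).trans hi) _ (red_iv hm) le_rfl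
  refine ⟨k, iv m', red_iv a, ?_, by rw [la_iv, c]⟩
  rw [ev_iv, b, ev_iv, ev_iv]; simp

lemma pow_head_stable {i j} (hij : i ≠ j) {l : List (Σ i, G i)} (hl : Red l) (hi : hd l = some i)
    (hj : la l = some j) {m : List (Σ i, G i)} (hm : Red m) (hmi : hd m = some i) (k : ℕ) :
    ∃ m', Red m' ∧ ev m' = ev l ^ k * ev m ∧ hd m' = some i := by
  induction k with
  | zero => exact ⟨m, hm, by simp, hmi⟩
  | succ k ih =>
    obtain ⟨m', a, b, c⟩ := ih
    refine ⟨l ++ m', red_append.2 ⟨hl, a, ?_⟩, ?_, ?_⟩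
    · intro s hs hs'
      rw [hj] at hs; rw [c] at hs'
      exact hij (by simpa using hs'.trans hs.symm)
    · rw [ev_append, b, pow_succ', mul_assoc]
    · rw [hd_append _ (ne_nil_of_hd hi), hi]

lemma list_comm {α : Type*} (u v : FreeMonoid α) (h : Commute u v) :
    u ^ v.length = v ^ u.length := by
  have hc : u ^ v.length * v ^ u.length = v ^ u.length * u ^ v.length := h.pow_pow _ _
  have hlen : ∀ (w : FreeMonoid α) (n : ℕ), (w ^ n).length = n * w.length := by
    intro w n
    induction n with
    | zero => simp
    | succ n ih => rw [pow_succ, FreeMonoid.length_mul, ih]; ring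
  refine (List.append_inj (s₁ := (u ^ v.length).toList) (s₂ := (v ^ u.length).toList)
    (t₁ := (v ^ u.length).toList) (t₂ := (u ^ v.length).toList) hc ?_).1
  change (u ^ v.length).length = (v ^ u.length).length
  rw [hlen, hlen, mul_comm]

lemma ev_comm_pow {l m : List (Σ i, G i)} (h : l ++ m = m ++ l) :
    ev l ^ m.length = ev m ^ l.length := by
  have := list_comm (FreeMonoid.ofList l) (FreeMonoid.ofList m) h
  have := congrArg (FreeMonoid.lift fun p : Σ i, G i => (CoprodI.of p.2 : CoprodI G)) this
  rw [map_pow, map_pow, FreeMonoid.lift_ofList, FreeMonoid.lift_ofList] at this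
  exact this

/-- The hyperbolic case. -/
lemma hyp_case {i j} (hij : i ≠ j) {l : List (Σ i, G i)} (hl : Red l) (hi : hd l = some i)
    (hj : la l = some j) (b : CoprodI G) (hb : Commute (ev l) b) :
    ∃ n m : ℤ, (n ≠ 0 ∨ m ≠ 0) ∧ ev l ^ n = b ^ m := by
  obtain ⟨m, hm, rfl⟩ := exists_red b
  obtain ⟨k, c, hc, hce, hci⟩ := exists_pow_head hl hi _ hm le_rfl
  obtain ⟨k', d, hd', hde, hdj⟩ := exists_pow_last hl hj hc
  obtain ⟨d', h1, h2, h3⟩ := pow_head_stable hij hl hi hj hc hci k'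
  have hcomm : Commute (ev l) (ev c) := by
    rw [hce]; exact ((Commute.refl _).pow_right _).mul_right hb
  have hdd : d' = d := by
    apply ev_inj h1 hd'
    rw [h2, hde]; exact hcomm.pow_left _
  subst hdd
  have hcomm2 : Commute (ev l) (ev d') := by
    rw [hde]; exact hcomm.mul_right ((Commute.refl _).pow_right _)
  have r1 : Red (l ++ d') := red_append.2 ⟨hl, h1, by
    intro s hs hs'
    rw [hj] at hs; rw [h3] at hs'
    exact hij (by simpa using hs'.trans hs.symm)⟩
  have r2 : Red (d' ++ l) := red_append.2 ⟨h1, hl, by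
    intro s hs hs'
    rw [hdj] at hs; rw [hi] at hs'
    exact hij (by simpa using hs'.trans hs.symm)⟩
  have e := ev_inj r1 r2 (by rw [ev_append, ev_append]; exact hcomm2)
  have e2 := ev_comm_pow e
  have hlen : l.length ≠ 0 := by simpa using ne_nil_of_hd hi
  have e3 : ev d' = ev l ^ (k' + k) * ev m := by rw [h2, hce, pow_add, mul_assoc]
  rw [e3, (hb.pow_left _).mul_pow, ← pow_mul] at e2
  refine ⟨(d'.length : ℤ) - ((k' + k) * l.length : ℕ), l.length, Or.inr (by exact_mod_cast hlen), ?_⟩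
  rw [zpow_sub, zpow_natCast, zpow_natCast, zpow_natCast, e2, mul_inv_eq_iff_eq_mul]
  exact hb.pow_pow _ _

/-- Malnormality of factors. -/
lemma malnormal {i j} {h : G i} (hh : h ≠ 1) {h' : G j} {x : CoprodI G}
    (hx : x * CoprodI.of h = CoprodI.of h' * x) : i = j ∧ ∃ g : G i, x = CoprodI.of g := by
  have hh' : h' ≠ 1 := by
    rintro rfl
    rw [map_one, one_mul] at hx
    apply hh
    apply CoprodI.of_injective (M := G) i
    rw [map_one]
    exact mul_eq_left.1 hx
  -- write x = y * of k
  obtain ⟨y, k, hy, hyi, rfl⟩ : ∃ (y : List (Σ i, G i)) (k : G i), Red y ∧ la y ≠ some i ∧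
      x = ev y * CoprodI.of k := by
    obtain ⟨l, hl, rfl⟩ := exists_red x
    by_cases hli : la l = some i
    · obtain ⟨g, t, rfl⟩ := la_eq hli
      rw [red_concat] at hl
      exact ⟨t, g, hl.1, hl.2.2, by simp⟩
    · exact ⟨l, 1, hl, hli, by simp⟩
  have key : ev (y ++ [⟨i, k * h * k⁻¹⟩]) = ev (⟨j, h'⟩ :: y) := by
    simp only [ev_append, ev_cons, ev_nil, map_mul, map_inv, mul_one]
    rw [← mul_assoc, ← mul_assoc, hx]; group
  have r1 : Red (y ++ [⟨i, k * h * k⁻¹⟩]) := red_concat.2 ⟨hy, by simpa using hh, hyi⟩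
  by_cases hyj : hd y = some j
  · exfalso
    obtain ⟨g, t, rfl⟩ := hd_eq hyj
    rw [red_cons] at hy
    by_cases hg : h' * g = 1
    · have := ev_inj r1 hy.2.1 (by
        rw [key, ev_cons, ev_cons, ← mul_assoc, ← map_mul, hg]; simp)
      have := congrArg List.length this
      simp at this
      omega
    · have := ev_inj r1 (m := ⟨j, h' * g⟩ :: t) (red_cons.2 ⟨hg, hy.2⟩) (by
        rw [key]; simp [mul_assoc])
      have := congrArg List.length this
      simp at this
  · have r2 : Red (⟨j, h'⟩ :: y) := red_cons.2 ⟨hh', hy, hyj⟩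
    have e := ev_inj r1 r2 key
    have e' := congrArg la e
    rw [la_concat] at e'
    rcases eq_or_ne y [] with rfl | hne
    · simp only [List.nil_append, List.cons.injEq, Sigma.mk.injEq] at e
      exact ⟨e.1.1, k, by simp⟩
    · rw [← List.singleton_append, la_append _ hne] at e'
      exact absurd e'.symm hyi

/-- Commuting elements in a free product. -/
lemma commute_cases (n : ℕ) (a b : CoprodI G) (hab : Commute a b)
    (l : List (Σ i, G i)) (hl : Red l) (hla : ev l = a) (hn : l.length ≤ n) :
    (∃ (g : CoprodI G) (i : ι) (p q : G i), a = g * CoprodI.of p * g⁻¹ ∧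
      b = g * CoprodI.of q * g⁻¹) ∨
    ∃ n m : ℤ, (n ≠ 0 ∨ m ≠ 0) ∧ a ^ n = b ^ m := by
  induction n generalizing a b l with
  | zero =>
    have : l = [] := by simpa using hn
    subst this
    exact Or.inr ⟨1, 0, by simp, by simp [← hla]⟩
  | succ n ih =>
    rcases hi : hd l with _ | i
    · have : l = [] := by
        rcases l with _ | _
        · rfl
        · simp at hi
      subst this
      exact Or.inr ⟨1, 0, by simp, by simp [← hla]⟩
    obtain ⟨g, t, rfl⟩ := hd_eq hi
    have hl' := hl
    rw [red_cons] at hl'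
    rcases t.eq_nil_or_concat' with rfl | ⟨t, ⟨j, h⟩, rfl⟩
    · left
      have hab' : b * CoprodI.of g = CoprodI.of g * b := by
        have := hab.eq
        rw [← hla] at this
        simpa using this.symm
      obtain ⟨-, q, rfl⟩ := malnormal hl'.1 hab'
      exact ⟨1, i, g, q, by simp [← hla], by simp⟩
    by_cases hij : i = j
    · subst hij
      have hc : Commute ((CoprodI.of g)⁻¹ * a * CoprodI.of g)
          ((CoprodI.of g)⁻¹ * b * CoprodI.of g) := by
        simpa using hab.map (MulAut.conj (CoprodI.of g : CoprodI G)⁻¹)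
      have hred := hl'.2.1
      rw [red_concat] at hred
      obtain ⟨l', r', e', len'⟩ : ∃ l' : List (Σ i, G i), Red l' ∧
          ev l' = (CoprodI.of g)⁻¹ * a * CoprodI.of g ∧ l'.length ≤ n := by
        have e0 : (CoprodI.of g)⁻¹ * a * CoprodI.of g = ev t * CoprodI.of (h * g) := by
          rw [← hla]; simp [mul_assoc]
        simp at hn
        by_cases hg : h * g = 1
        · exact ⟨t, hred.1, by rw [e0, hg]; simp, by omega⟩
        · exact ⟨t ++ [⟨i, h * g⟩], red_concat.2 ⟨hred.1, hg, hred.2.2⟩, by rw [e0]; simp,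
            by simp; omega⟩
      rcases ih _ _ hc l' r' e' len' with ⟨k, s, p, q, hp, hq⟩ | ⟨u, v, huv, e⟩
      · left
        refine ⟨CoprodI.of g * k, s, p, q, ?_, ?_⟩
        · have : a = CoprodI.of g * ((CoprodI.of g)⁻¹ * a * CoprodI.of g) * (CoprodI.of g)⁻¹ := by
            group
          rw [this, hp]; group
        · have : b = CoprodI.of g * ((CoprodI.of g)⁻¹ * b * CoprodI.of g) * (CoprodI.of g)⁻¹ := by
            group
          rw [this, hq]; group
      · right
        refine ⟨u, v, huv, ?_⟩
        have cz : ∀ (x : CoprodI G) (z : ℤ), ((CoprodI.of g)⁻¹ * x * CoprodI.of g) ^ z =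
            (CoprodI.of g)⁻¹ * x ^ z * CoprodI.of g := by
          intro x z
          have := conj_zpow (i := z) (a := (CoprodI.of g : CoprodI G)⁻¹) (b := x)
          simpa using this
        rw [cz, cz] at e
        simpa using e
    · right
      have := hyp_case hij hl hi (by rw [← List.cons_append, la_concat]) b (by rwa [hla])
      rwa [hla] at this

lemma exists_conj_ends {t : ι} {p : G t} (hp : p ≠ 1) (hp2 : p ^ 2 ≠ 1) {u : CoprodI G}
    (hu : u ≠ 1) : ∃ (k : ℕ) (l : List (Σ i, G i)), Red l ∧
      ev l = CoprodI.of p ^ k * u * (CoprodI.of p ^ k)⁻¹ ∧ hd l = some t ∧ la l = some t := by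
  obtain ⟨l, hl, rfl⟩ := exists_red u
  have hne : l ≠ [] := by rintro rfl; simp at hu
  have choice : ∀ k : G t, ∃ n : ℕ, p ^ n ≠ 1 ∧ p ^ n ≠ k := by
    intro k
    by_cases h : p = k
    · refine ⟨2, hp2, ?_⟩
      rw [← h, pow_two]; simpa using hp
    · exact ⟨1, by simpa using hp, by simpa using h⟩
  by_cases h1 : hd l = some t
  · by_cases h2 : la l = some t
    · exact ⟨0, l, hl, by simp, h1, h2⟩
    · obtain ⟨k, r, rfl⟩ := hd_eq h1
      have hr : r ≠ [] := by rintro rfl; simp [la] at h2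
      obtain ⟨n, hn, hn'⟩ := choice k⁻¹
      rw [red_cons] at hl
      rw [← List.singleton_append, la_append _ hr] at h2
      have h3 : p ^ n * k ≠ 1 := fun h => hn' (eq_inv_of_mul_eq_one_left h)
      refine ⟨n, ⟨t, p ^ n * k⟩ :: (r ++ [⟨t, (p ^ n)⁻¹⟩]), ?_, ?_, by simp, ?_⟩
      · rw [red_cons, red_concat, hd_append _ hr]
        exact ⟨h3, ⟨hl.2.1, by simpa using hn, h2⟩, hl.2.2⟩
      · simp [mul_assoc]
      · rw [← List.cons_append, la_concat]
  · by_cases h2 : la l = some t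
    · obtain ⟨k, r, rfl⟩ := la_eq h2
      have hr : r ≠ [] := by rintro rfl; simp at h1
      obtain ⟨n, hn, hn'⟩ := choice k
      rw [red_concat] at hl
      rw [hd_append _ hr] at h1
      have h3 : k * (p ^ n)⁻¹ ≠ 1 := fun h => hn' (mul_inv_eq_one.1 h).symm
      refine ⟨n, ⟨t, p ^ n⟩ :: (r ++ [⟨t, k * (p ^ n)⁻¹⟩]), ?_, ?_, by simp, ?_⟩
      · rw [red_cons, red_concat, hd_append _ hr]
        exact ⟨hn, ⟨hl.1, h3, hl.2.2⟩, h1⟩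
      · simp [mul_assoc]
      · rw [← List.cons_append, la_concat]
    · refine ⟨1, ⟨t, p⟩ :: (l ++ [⟨t, p⁻¹⟩]), ?_, ?_, by simp, ?_⟩
      · rw [red_cons, red_concat, hd_append _ hne]
        exact ⟨hp, ⟨hl, by simpa using hp, h2⟩, h1⟩
      · simp [mul_assoc]
      · rw [← List.cons_append, la_concat]

/-- A primeness property of free products. -/
lemma prime_coprod {s t : ι} (hst : s ≠ t) {p : G t} (hp : p ≠ 1) (hp2 : p ^ 2 ≠ 1)
    {q : G s} (hq : q ≠ 1) {u v : CoprodI G} (hu : u ≠ 1) (hv : v ≠ 1) :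
    ∃ k m : ℕ, ¬ Commute (CoprodI.of q * (CoprodI.of p ^ k * u * (CoprodI.of p ^ k)⁻¹) *
      (CoprodI.of q)⁻¹) (CoprodI.of p ^ m * v * (CoprodI.of p ^ m)⁻¹) := by
  obtain ⟨k, l, hl, el, hl1, hl2⟩ := exists_conj_ends hp hp2 hu
  obtain ⟨m, l', hl', el', hl1', hl2'⟩ := exists_conj_ends hp hp2 hv
  refine ⟨k, m, fun h => ?_⟩
  rw [← el, ← el'] at h
  have e : ev ((⟨s, q⟩ :: (l ++ [⟨s, q⁻¹⟩])) ++ l') = ev (l' ++ (⟨s, q⟩ :: (l ++ [⟨s, q⁻¹⟩]))) := by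
    simpa [mul_assoc] using h.eq
  have hn := ne_nil_of_hd hl1
  have hst' : some t ≠ some s := fun h => hst (by simpa using h.symm)
  have hr : Red (⟨s, q⟩ :: (l ++ [⟨s, q⁻¹⟩])) := by
    rw [red_cons, red_concat, hd_append _ hn, hl1, hl2]
    exact ⟨hq, ⟨hl, by simpa using hq, hst'⟩, hst'⟩
  have e' := ev_inj (red_append.2 ⟨hr, hl', ?_⟩) (red_append.2 ⟨hl', hr, ?_⟩) e
  · have := congrArg hd e'
    rw [hd_append _ (by simp), hd_append _ (ne_nil_of_hd hl1'), hl1'] at this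
    exact hst' (by simpa using this.symm)
  · intro i hi
    rw [← List.cons_append, la_concat] at hi
    rw [hl1', ← hi]; exact hst'
  · intro i hi
    rw [hl2'] at hi
    rw [← hi, hd_cons]; exact hst'.symm

lemma not_commute_coprod {s t : ι} (hst : s ≠ t) {p : G t} (hp : p ≠ 1)
    {q : G s} (hq : q ≠ 1) : ¬ Commute (CoprodI.of q : CoprodI G) (CoprodI.of p) := by
  intro h
  have e := ev_inj (l := [⟨s, q⟩, ⟨t, p⟩]) (m := [⟨t, p⟩, ⟨s, q⟩])
    (red_cons.2 ⟨hq, red_single hp, by simpa using hst.symm⟩)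
    (red_cons.2 ⟨hp, red_single hq, by simpa using hst⟩) (by simpa using h.eq)
  simp at e
  exact hst e.1.1
end words

section free

lemma of_unit_zpow {n : ℤ} (hn : n ≠ 0) : (FreeGroup.of () : FreeGroup Unit) ^ n ≠ 1 := by
  intro h
  have := congrArg (FreeGroup.lift fun _ => Multiplicative.ofAdd (1 : ℤ)) h
  rw [map_zpow, FreeGroup.lift_apply_of, MonoidHom.map_one, ← ofAdd_zsmul] at this
  have : n • (1 : ℤ) = 0 := this
  simp at this
  exact hn this

lemma equiv_of {α : Type*} (a : α) : freeGroupEquivCoprodI (FreeGroup.of a) =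
    (Monoid.CoprodI.of (i := a) (FreeGroup.of ()) : CoprodI fun _ : α => FreeGroup Unit) := by
  simp [freeGroupEquivCoprodI]

lemma prime_free {α : Type*} {s t : α} (hst : s ≠ t) {u v : FreeGroup α} (hu : u ≠ 1)
    (hv : v ≠ 1) : ∃ k m : ℕ, ¬ Commute (FreeGroup.of s * (FreeGroup.of t ^ k * u *
      (FreeGroup.of t ^ k)⁻¹) * (FreeGroup.of s)⁻¹)
      (FreeGroup.of t ^ m * v * (FreeGroup.of t ^ m)⁻¹) := by
  have h1 : (FreeGroup.of () : FreeGroup Unit) ≠ 1 := by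
    simp
  have h2 : (FreeGroup.of () : FreeGroup Unit) ^ 2 ≠ 1 := by
    have := of_unit_zpow (n := 2) (by simp)
    exact_mod_cast this
  obtain ⟨k, m, h⟩ := prime_coprod (G := fun _ : α => FreeGroup Unit) hst h1 h2 h1
    (u := freeGroupEquivCoprodI u) (v := freeGroupEquivCoprodI v) ((map_ne_one_iff _ (freeGroupEquivCoprodI (ι := α)).injective).2 hu)
    ((map_ne_one_iff _ (freeGroupEquivCoprodI (ι := α)).injective).2 hv)
  refine ⟨k, m, fun hc => h ?_⟩
  simpa only [MulEquiv.toMonoidHom_eq_coe, MonoidHom.coe_coe, map_mul, map_inv, map_pow, equiv_of] using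
    hc.map (freeGroupEquivCoprodI (ι := α)).toMonoidHom

lemma not_commute_free {α : Type*} {s t : α} (hst : s ≠ t) {n m : ℤ} (hn : n ≠ 0) (hm : m ≠ 0) :
    ¬ Commute (FreeGroup.of s ^ n) (FreeGroup.of t ^ m) := by
  intro hc
  apply not_commute_coprod (G := fun _ : α => FreeGroup Unit) hst (of_unit_zpow hm)
    (of_unit_zpow hn)
  have := hc.map (freeGroupEquivCoprodI (ι := α)).toMonoidHom
  simp only [MulEquiv.toMonoidHom_eq_coe, MonoidHom.coe_coe, map_zpow, equiv_of] at this
  simpa only [map_zpow] using this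
end free
end KK
namespace KK
open Monoid
open scoped commutatorElement

section raag

/-- Universal property of RAAGs. -/
def raagLift {V H : Type*} [Group H] {Γ : SimpleGraph V} (φ : V → H)
    (h : ∀ u v, Γ.Adj u v → Commute (φ u) (φ v)) : RAAG Γ →* H :=
  PresentedGroup.toGroup (f := φ) (rels := raagRels Γ) (by
    rintro r ⟨u, v, huv, rfl⟩
    simp only [map_mul, map_inv, FreeGroup.lift_apply_of]
    rw [(h u v huv).eq]; group)

@[simp] lemma raagLift_of {V H : Type*} [Group H] {Γ : SimpleGraph V} (φ : V → H)
    (h : ∀ u v, Γ.Adj u v → Commute (φ u) (φ v)) (v : V) :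
    raagLift φ h (PresentedGroup.of v : RAAG Γ) = φ v := by
  simp [raagLift]

lemma raag_comm {V : Type*} {Γ : SimpleGraph V} {u v : V} (h : Γ.Adj u v) :
    Commute (PresentedGroup.of u : RAAG Γ) (PresentedGroup.of v) := by
  have h1 : (PresentedGroup.mk (raagRels Γ)) (FreeGroup.of u * FreeGroup.of v *
      (FreeGroup.of u)⁻¹ * (FreeGroup.of v)⁻¹) = 1 :=
    PresentedGroup.one_of_mem ⟨u, v, h, rfl⟩
  simp only [map_mul, map_inv] at h1
  rw [mul_inv_eq_one, mul_inv_eq_iff_eq_mul] at h1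
  exact h1.trans rfl

/-- The group `A(P₄)`. -/
abbrev AP := RAAG (SimpleGraph.pathGraph 4)

/-- Generators of `A(P₄)`. -/
abbrev x (i : Fin 4) : AP := PresentedGroup.of i

lemma pathAdj (i j : Fin 4) : (SimpleGraph.pathGraph 4).Adj i j ↔
    (i = 0 ∧ j = 1) ∨ (i = 1 ∧ j = 0) ∨ (i = 1 ∧ j = 2) ∨ (i = 2 ∧ j = 1) ∨
    (i = 2 ∧ j = 3) ∨ (i = 3 ∧ j = 2) := by
  rw [SimpleGraph.pathGraph_adj]
  revert i j; decide

lemma x01 : Commute (x 0) (x 1) := raag_comm (by simp [pathAdj])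
lemma x12 : Commute (x 1) (x 2) := raag_comm (by simp [pathAdj])
lemma x23 : Commute (x 2) (x 3) := raag_comm (by simp [pathAdj])

/-- Homomorphisms out of `A(P₄)`. -/
def apLift {H : Type*} [Group H] (y : Fin 4 → H) (h01 : Commute (y 0) (y 1))
    (h12 : Commute (y 1) (y 2)) (h23 : Commute (y 2) (y 3)) : AP →* H :=
  raagLift y (by
    intro i j h
    rw [pathAdj] at h
    rcases h with ⟨rfl, rfl⟩ | ⟨rfl, rfl⟩ | ⟨rfl, rfl⟩ | ⟨rfl, rfl⟩ | ⟨rfl, rfl⟩ | ⟨rfl, rfl⟩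
    exacts [h01, h01.symm, h12, h12.symm, h23, h23.symm])

/-- The auxiliary free group. -/
abbrev F := FreeGroup (ℤ × ℤ)

/-- Left multiplication. -/
def L : F →* Equiv.Perm F := MulAction.toPermHom F F

lemma L_apply (u v : F) : L u v = u * v := rfl

lemma L_inj : Function.Injective L := by
  intro u v h
  have := congrArg (fun e : Equiv.Perm F => e 1) h
  simpa [L_apply] using this

/-- Permuting the generators. -/
def Mp : Equiv.Perm (ℤ × ℤ) →* Equiv.Perm F where
  toFun σ := (FreeGroup.freeGroupCongr σ).toEquiv
  map_one' := by
    ext u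
    simp
  map_mul' σ τ := by
    ext u
    simp [FreeGroup.map.comp]

lemma Mp_apply (σ : Equiv.Perm (ℤ × ℤ)) (u : F) : Mp σ u = FreeGroup.map σ u := rfl

lemma Mp_L (σ : Equiv.Perm (ℤ × ℤ)) (u : F) : Mp σ * L u * (Mp σ)⁻¹ = L (FreeGroup.map σ u) := by
  rw [mul_inv_eq_iff_eq_mul]
  ext v
  simp [Mp_apply, L_apply]

/-- First shear. -/
def σ₂ : Equiv.Perm (ℤ × ℤ) where
  toFun p := (p.1 + p.2, p.2)
  invFun p := (p.1 - p.2, p.2)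
  left_inv p := by simp
  right_inv p := by simp

/-- Second shear. -/
def σ₄ : Equiv.Perm (ℤ × ℤ) where
  toFun p := (p.1, p.2 + p.1)
  invFun p := (p.1, p.2 - p.1)
  left_inv p := by simp
  right_inv p := by simp

lemma σ₂_zpow (n : ℤ) (p : ℤ × ℤ) : (σ₂ ^ n) p = (p.1 + n * p.2, p.2) := by
  induction n generalizing p with
  | zero => simp
  | succ n ih =>
    rw [zpow_add_one, Equiv.Perm.mul_apply, ih]
    simp [σ₂]; ring
  | pred n ih =>
    rw [zpow_sub_one, Equiv.Perm.mul_apply, ih]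
    have : σ₂⁻¹ p = (p.1 - p.2, p.2) := rfl
    rw [this]
    simp; ring

lemma σ₄_zpow (n : ℤ) (p : ℤ × ℤ) : (σ₄ ^ n) p = (p.1, p.2 + n * p.1) := by
  induction n generalizing p with
  | zero => simp
  | succ n ih =>
    rw [zpow_add_one, Equiv.Perm.mul_apply, ih]
    simp [σ₄]; ring
  | pred n ih =>
    rw [zpow_sub_one, Equiv.Perm.mul_apply, ih]
    have : σ₄⁻¹ p = (p.1, p.2 - p.1) := rfl
    rw [this]
    simp; ring

lemma Mp_comm {σ : Equiv.Perm (ℤ × ℤ)} {s : ℤ × ℤ} (h : σ s = s) :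
    Commute (Mp σ) (L (FreeGroup.of s)) := by
  have := Mp_L σ (FreeGroup.of s)
  rw [FreeGroup.map.of, h, mul_inv_eq_iff_eq_mul] at this
  exact this

/-- The auxiliary representation of `A(P₄)`. -/
def ρ : AP →* Equiv.Perm F :=
  apLift ![L (FreeGroup.of (1, 0)), Mp σ₂, L (FreeGroup.of (0, 0)), Mp σ₄]
    (Mp_comm (by simp [σ₂])).symm (Mp_comm (by simp [σ₂])) (Mp_comm (by simp [σ₄])).symm

lemma ρ0 : ρ (x 0) = L (FreeGroup.of (1, 0)) := by simp [ρ, apLift]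
lemma ρ1 : ρ (x 1) = Mp σ₂ := by simp [ρ, apLift]
lemma ρ2 : ρ (x 2) = L (FreeGroup.of (0, 0)) := by simp [ρ, apLift]
lemma ρ3 : ρ (x 3) = Mp σ₄ := by simp [ρ, apLift]

/-- Groups for which every homomorphism from `A(P₄)` kills an element detected by `ρ`. -/
def T (H : Type*) [Group H] : Prop :=
  ∀ f : AP →* H, ∃ w, f w = 1 ∧ ∃ u : F, u ≠ 1 ∧ ρ w = L u

lemma T.not_injective {H : Type*} [Group H] (h : T H) (f : AP →* H) :
    ¬ Function.Injective f := by
  intro hf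
  obtain ⟨w, hw, u, hu, e⟩ := h f
  have : w = 1 := hf (by rw [hw, map_one])
  rw [this, map_one] at e
  exact hu (L_inj (by rw [← e, map_one]))

lemma T.of_injective {H K : Type*} [Group H] [Group K] (h : T K) (φ : H →* K)
    (hφ : Function.Injective φ) : T H := by
  intro f
  obtain ⟨w, hw, r⟩ := h (φ.comp f)
  exact ⟨w, hφ (by rw [map_one]; exact hw), r⟩

lemma T.prod {H K : Type*} [Group H] [Group K] (h : T H) (k : T K) : T (H × K) := by
  intro f
  obtain ⟨w, hw, u, hu, e⟩ := h ((MonoidHom.fst H K).comp f)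
  obtain ⟨w', hw', u', hu', e'⟩ := k ((MonoidHom.snd H K).comp f)
  obtain ⟨a, b, hab⟩ := prime_free (s := ((1, 0) : ℤ × ℤ)) (t := (0, 0)) (by simp) hu hu'
  refine ⟨⁅x 0 * (x 2 ^ a * w * (x 2 ^ a)⁻¹) * (x 0)⁻¹, x 2 ^ b * w' * (x 2 ^ b)⁻¹⁆, ?_,
    ⁅FreeGroup.of (1, 0) * (FreeGroup.of (0, 0) ^ a * u * (FreeGroup.of (0, 0) ^ a)⁻¹) *
      (FreeGroup.of (1, 0))⁻¹, FreeGroup.of (0, 0) ^ b * u' * (FreeGroup.of (0, 0) ^ b)⁻¹⁆, ?_, ?_⟩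
  · simp only [MonoidHom.comp_apply, MonoidHom.coe_fst, MonoidHom.coe_snd] at hw hw'
    ext
    · simp [commutatorElement_def, hw]
    · simp [commutatorElement_def, hw']; group
  · rwa [Ne, commutatorElement_eq_one_iff_commute]
  · simp only [commutatorElement_def, map_mul, map_inv, map_pow, e, e', ρ0, ρ2]

lemma base1 {H : Type*} [Group H] (f : AP →* H) {n m : ℤ} (hn : n ≠ 0) (hm : m ≠ 0)
    (h : Commute (f (x 0) ^ n) (f (x 2) ^ m)) :
    ∃ w, f w = 1 ∧ ∃ u : F, u ≠ 1 ∧ ρ w = L u := by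
  refine ⟨⁅x 0 ^ n, x 2 ^ m⁆, ?_, ⁅(FreeGroup.of (1, 0) : F) ^ n, (FreeGroup.of (0, 0) : F) ^ m⁆, ?_, ?_⟩
  · rw [map_commutatorElement, commutatorElement_eq_one_iff_commute, map_zpow, map_zpow]
    exact h
  · rw [Ne, commutatorElement_eq_one_iff_commute]
    exact not_commute_free (by simp) hn hm
  · simp only [commutatorElement_def, map_mul, map_inv, map_zpow, ρ0, ρ2]

lemma base2 {H : Type*} [Group H] (f : AP →* H) {n m : ℤ} (hn : n ≠ 0) (hm : m ≠ 0)
    (h : Commute (f (x 1) ^ n) (f (x 3) ^ m)) :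
    ∃ w, f w = 1 ∧ ∃ u : F, u ≠ 1 ∧ ρ w = L u := by
  refine ⟨⁅x 1 ^ n, x 3 ^ m * x 0 * (x 3 ^ m)⁻¹⁆, ?_,
    FreeGroup.of (1 + n * m, m) * (FreeGroup.of (1, m))⁻¹, ?_, ?_⟩
  · rw [map_commutatorElement, commutatorElement_eq_one_iff_commute]
    simp only [map_mul, map_inv, map_zpow]
    have h0 : Commute (f (x 1) ^ n) (f (x 0)) := (x01.symm.map f).zpow_left n
    exact (h.mul_right h0).mul_right h.inv_right
  · rw [Ne, mul_inv_eq_one]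
    intro e
    have := FreeGroup.of_injective e
    simp [hn, hm] at this
  · have e1 : ρ (x 3 ^ m * x 0 * (x 3 ^ m)⁻¹) = L (FreeGroup.of (1, m)) := by
      simp only [map_mul, map_inv, map_zpow, ρ0, ρ3]
      rw [← map_zpow, Mp_L, FreeGroup.map.of, σ₄_zpow]
      simp
    rw [commutatorElement_def, map_mul, map_mul, map_mul, map_inv, map_inv, e1]
    rw [map_zpow, ρ1, ← map_zpow, Mp_L, FreeGroup.map.of, σ₂_zpow, map_mul, map_inv]

lemma T.of_comm {H : Type*} [CommGroup H] : T H := fun f =>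
  base1 f one_ne_zero one_ne_zero (Commute.all _ _)

lemma T.coprodI {ι : Type*} {G : ι → Type*} [∀ i, Group (G i)] (h : ∀ i, T (G i)) :
    T (CoprodI G) := by
  intro f
  have cc : ∀ a b : CoprodI G, Commute a b →
      (∃ (g : CoprodI G) (i : ι) (p q : G i), a = g * CoprodI.of p * g⁻¹ ∧
        b = g * CoprodI.of q * g⁻¹) ∨
      ∃ n m : ℤ, (n ≠ 0 ∨ m ≠ 0) ∧ a ^ n = b ^ m := fun a b hab => by
    obtain ⟨l, hl, e⟩ := exists_red a
    exact commute_cases _ a b hab l hl e le_rfl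
  have p12 : (∃ n m : ℤ, (n ≠ 0 ∨ m ≠ 0) ∧ f (x 1) ^ n = f (x 2) ^ m) →
      ∃ w, f w = 1 ∧ ∃ u : F, u ≠ 1 ∧ ρ w = L u := by
    rintro ⟨n, m, hnm, e⟩
    by_cases hn : n = 0
    · have hm : m ≠ 0 := hnm.resolve_left (by simpa using hn)
      refine base1 f one_ne_zero hm ?_
      rw [← e, hn, zpow_zero]; exact Commute.one_right _
    · refine base2 f hn one_ne_zero ?_
      rw [e]
      exact ((x23.map f).zpow_left m).zpow_right 1
  by_cases h1 : f (x 1) = 1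
  · exact p12 ⟨1, 0, by simp, by simp [h1]⟩
  by_cases h2 : f (x 2) = 1
  · exact p12 ⟨0, 1, by simp, by simp [h2]⟩
  rcases cc _ _ (x12.map f) with ⟨g, i, b, c, hb, hc⟩ | hp
  swap
  · exact p12 hp
  rcases cc _ _ (x01.map f) with ⟨g', i', a, b', ha, hb'⟩ | ⟨n, m, hnm, e⟩
  swap
  · by_cases hn : n = 0
    · have hm : m ≠ 0 := hnm.resolve_left (by simpa using hn)
      refine base2 f hm one_ne_zero ?_
      rw [← e, hn, zpow_zero]; exact Commute.one_left _
    · refine base1 f hn one_ne_zero ?_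
      rw [e]
      exact ((x12.map f).zpow_left m).zpow_right 1
  rcases cc _ _ (x23.map f) with ⟨g'', i'', c', d, hc', hd'⟩ | ⟨n, m, hnm, e⟩
  swap
  · by_cases hm : m = 0
    · have hn : n ≠ 0 := hnm.resolve_right (by simpa using hm)
      refine base1 f one_ne_zero hn ?_
      rw [e, hm, zpow_zero]; exact Commute.one_right _
    · refine base2 f one_ne_zero hm ?_
      rw [← e]
      exact ((x12.map f).zpow_right n).zpow_left 1
  -- all elements lie in the same conjugate of a factor
  have hb1 : b ≠ 1 := by rintro rfl; apply h1; rw [hb]; simp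
  have hc1 : c ≠ 1 := by rintro rfl; apply h2; rw [hc]; simp
  have m1 : (g'⁻¹ * g) * CoprodI.of b = CoprodI.of b' * (g'⁻¹ * g) := by
    have e := hb.symm.trans hb'
    rw [mul_inv_eq_iff_eq_mul] at e
    rw [mul_assoc, e]; group
  have m2 : (g''⁻¹ * g) * CoprodI.of c = CoprodI.of c' * (g''⁻¹ * g) := by
    have e := hc.symm.trans hc'
    rw [mul_inv_eq_iff_eq_mul] at e
    rw [mul_assoc, e]; group
  obtain ⟨rfl, r, hr⟩ := malnormal hb1 m1
  obtain ⟨rfl, s, hs⟩ := malnormal hc1 m2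
  obtain rfl : g' = g * (CoprodI.of r)⁻¹ := by rw [← hr]; group
  obtain rfl : g'' = g * (CoprodI.of s)⁻¹ := by rw [← hs]; group
  have ha2 : f (x 0) = g * CoprodI.of (r⁻¹ * a * r) * g⁻¹ := by
    rw [ha]; simp [mul_assoc]
  have hd2 : f (x 3) = g * CoprodI.of (s⁻¹ * d * s) * g⁻¹ := by
    rw [hd']; simp [mul_assoc]
  have cm : ∀ (p q : G i) (y z : CoprodI G), Commute y z → y = g * CoprodI.of p * g⁻¹ →
      z = g * CoprodI.of q * g⁻¹ → Commute p q := by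
    rintro p q y z hyz rfl rfl
    have := (Commute.conj_iff g).1 hyz
    apply CoprodI.of_injective (M := G) i
    rw [map_mul, map_mul]; exact this
  let f' : AP →* G i := apLift ![r⁻¹ * a * r, b, c, s⁻¹ * d * s]
    (cm _ _ _ _ (x01.map f) ha2 hb) (cm _ _ _ _ (x12.map f) hb hc) (cm _ _ _ _ (x23.map f) hc hd2)
  have hff : f = (MulAut.conj g).toMonoidHom.comp (CoprodI.of.comp f') := by
    apply PresentedGroup.ext
    intro j
    have h0 : f' (x 0) = r⁻¹ * a * r := by simp [f', apLift]
    have h1 : f' (x 1) = b := by simp [f', apLift]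
    have h2 : f' (x 2) = c := by simp [f', apLift]
    have h3 : f' (x 3) = s⁻¹ * d * s := by simp [f', apLift]
    fin_cases j
    · change f (x 0) = g * CoprodI.of (f' (x 0)) * g⁻¹
      rw [h0, ha2]
    · change f (x 1) = g * CoprodI.of (f' (x 1)) * g⁻¹
      rw [h1, hb]
    · change f (x 2) = g * CoprodI.of (f' (x 2)) * g⁻¹
      rw [h2, hc]
    · change f (x 3) = g * CoprodI.of (f' (x 3)) * g⁻¹
      rw [h3, hd2]
  obtain ⟨w, hw, rest⟩ := h i f'
  refine ⟨w, ?_, rest⟩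
  rw [hff]
  simp [hw]

end raag
end KK
namespace KK
open Monoid

section graph

/-- A nontrivial partition with no `R`-relation across. -/
def Splits {V : Type*} (R : V → V → Prop) (s : Finset V) : Prop :=
  ∃ U : Set V, (∃ a ∈ s, a ∈ U) ∧ (∃ b ∈ s, b ∉ U) ∧
    ∀ a ∈ s, ∀ b ∈ s, a ∈ U → b ∉ U → ¬ R a b

/-- No induced path on four vertices. -/
def NoP {V : Type*} (Γ : SimpleGraph V) : Prop :=
  ∀ a b c d : V, Γ.Adj a b → Γ.Adj b c → Γ.Adj c d → ¬ Γ.Adj a c → ¬ Γ.Adj b d → ¬ Γ.Adj a d →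
    a ≠ c → b ≠ d → a ≠ d → False

lemma NoP.compl {V : Type*} {Γ : SimpleGraph V} (h : NoP Γ) : NoP Γᶜ := by
  intro a b c d hab hbc hcd hac hbd had nac nbd nad
  simp only [SimpleGraph.compl_adj, not_and, not_not] at *
  exact h b d a c (hbd nbd) (had nad).symm (hac nac) (fun e => hab.2 e.symm)
    (fun e => hcd.2 e.symm) hbc.2 hab.1.symm hcd.1.symm hbc.1

lemma splits_insert {V : Type*} [DecidableEq V] {Γ : SimpleGraph V} (h : NoP Γ) {s : Finset V}
    (hs : Splits Γ.Adj s) {v : V} (hv : v ∉ s) :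
    Splits Γ.Adj (insert v s) ∨ Splits Γᶜ.Adj (insert v s) := by
  obtain ⟨U, ⟨a0, ha0, ha0U⟩, ⟨b0, hb0, hb0U⟩, hU⟩ := hs
  by_cases hall : ∀ a ∈ s, Γ.Adj v a
  · right
    refine ⟨{v}, ⟨v, by simp, rfl⟩, ⟨a0, by simp [ha0], ?_⟩, ?_⟩
    · rintro rfl; exact hv ha0
    · rintro a - b hb rfl hbv hab
      rw [Finset.mem_insert] at hb
      exact hab.2 (hall b (hb.resolve_left hbv))
  push Not at hall
  obtain ⟨q, hq, hvq⟩ := hall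
  let C : Set V := {p | Relation.ReflTransGen (fun a b => b ∈ s ∧ Γ.Adj a b) q p}
  have hqC : q ∈ C := Relation.ReflTransGen.refl
  have hstep : ∀ a b, a ∈ C → b ∈ s → Γ.Adj a b → b ∈ C := fun a b ha hb hab =>
    Relation.ReflTransGen.tail ha ⟨hb, hab⟩
  have hCind : ∀ P : V → Prop, P q → (∀ a b, a ∈ C → a ∈ s → b ∈ C → b ∈ s → Γ.Adj a b →
      P a → P b) → ∀ p ∈ C, p ∈ s ∧ P p := by
    intro P hPq hP p hp
    induction hp with
    | refl => exact ⟨hq, hPq⟩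
    | @tail b c hb hc ih => exact ⟨hc.1, hP b c hb ih.1 (hstep b c hb hc.1 hc.2) hc.1 hc.2 ih.2⟩
  have hCs : ∀ p ∈ C, p ∈ s := fun p hp => (hCind (fun _ => True) trivial (by simp) p hp).1
  obtain ⟨r0, hr0, hr0C⟩ : ∃ r ∈ s, r ∉ C := by
    by_cases hqU : q ∈ U
    · refine ⟨b0, hb0, fun hb => hb0U ?_⟩
      refine (hCind (· ∈ U) hqU ?_ b0 hb).2
      intro a b _ has _ hbs hab haU
      by_contra hbU
      exact hU a has b hbs haU hbU hab
    · refine ⟨a0, ha0, fun hb => ?_⟩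
      refine (hCind (· ∉ U) hqU ?_ a0 hb).2 ha0U
      intro a b _ has _ hbs hab haU hbU
      exact hU b hbs a has hbU haU hab.symm
  by_cases h1 : ∃ p ∈ C, Γ.Adj v p
  swap
  · push Not at h1
    left
    refine ⟨C, ⟨q, by simp [hq], hqC⟩, ⟨r0, by simp [hr0], hr0C⟩, ?_⟩
    intro a _ b hb haC hbC hab
    rw [Finset.mem_insert] at hb
    rcases hb with rfl | hb
    · exact h1 a haC hab.symm
    · exact hbC (hstep a b haC hb hab)
  by_cases h2 : ∃ r ∈ s, r ∉ C ∧ Γ.Adj v r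
  swap
  · push Not at h2
    left
    refine ⟨{r | r ∈ s ∧ r ∉ C}, ⟨r0, by simp [hr0], hr0, hr0C⟩, ⟨v, by simp, fun e => hv e.1⟩, ?_⟩
    rintro a _ b hb ⟨has, haC⟩ hbU hab
    rw [Finset.mem_insert] at hb
    rcases hb with rfl | hb
    · exact h2 a has haC hab.symm
    · have hbC : b ∈ C := by
        by_contra hbC; exact hbU ⟨hb, hbC⟩
      exact haC (hstep b a hbC has hab.symm)
  exfalso
  obtain ⟨r, hr, hrC, hvr⟩ := h2
  obtain ⟨p0, hp0, hvp0⟩ := h1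
  obtain ⟨q', p', hq', hp', hqp, hvq', hvp'⟩ : ∃ q' p', q' ∈ C ∧ p' ∈ C ∧ Γ.Adj q' p' ∧
      ¬ Γ.Adj v q' ∧ Γ.Adj v p' := by
    by_contra hcon
    push Not at hcon
    refine (hCind (fun p => ¬ Γ.Adj v p) hvq ?_ p0 hp0).2 hvp0
    intro a b haC _ hbC _ hab hva
    exact hcon a b haC hbC hab hva
  refine h r v p' q' hvr.symm hvp' hqp.symm (fun e => hrC (hstep _ _ hp' hr e.symm)) hvq'
    (fun e => hrC (hstep _ _ hq' hr e.symm)) ?_ ?_ ?_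
  · rintro rfl; exact hrC hp'
  · rintro rfl; exact hv (hCs _ hq')
  · rintro rfl; exact hrC hq'

lemma seinsche {V : Type*} {Γ : SimpleGraph V} (h : NoP Γ) (s : Finset V)
    (hs : 2 ≤ s.card) : Splits Γ.Adj s ∨ Splits Γᶜ.Adj s := by
  classical
  induction s using Finset.induction_on with
  | empty => simp at hs
  | insert v s hv ih =>
    by_cases h2 : 2 ≤ s.card
    · rcases ih h2 with h3 | h3
      · exact splits_insert h h3 hv
      · have := splits_insert h.compl h3 hv
        rw [compl_compl] at this
        exact this.symm
    · rw [Finset.card_insert_of_notMem hv] at hs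
      obtain ⟨a, rfl⟩ := Finset.card_eq_one.1 (show s.card = 1 by omega)
      have hva : v ≠ a := by simpa using hv
      by_cases hadj : Γ.Adj v a
      · right
        refine ⟨{v}, ⟨v, by simp, rfl⟩, ⟨a, by simp, hva.symm⟩, ?_⟩
        rintro b - c hc rfl hcv hbc
        have : c = a := by simpa [show c ≠ b from hcv] using hc
        subst this
        exact hbc.2 hadj
      · left
        refine ⟨{v}, ⟨v, by simp, rfl⟩, ⟨a, by simp, hva.symm⟩, ?_⟩
        rintro b - c hc rfl hcv hbc
        have : c = a := by simpa [show c ≠ b from hcv] using hc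
        subst this
        exact hadj hbc

end graph

section final

lemma raag_comm_all {V H : Type*} [Group H] {Γ : SimpleGraph V} (f : RAAG Γ →* H) (z : H)
    (h : ∀ v, Commute z (f (PresentedGroup.of v))) (a : RAAG Γ) : Commute z (f a) := by
  have h1 : Subgroup.closure (Set.range (PresentedGroup.of : V → RAAG Γ)) ≤
      (Subgroup.centralizer {z}).comap f := by
    rw [Subgroup.closure_le]
    rintro _ ⟨v, rfl⟩
    simp only [Subgroup.coe_comap, Set.mem_preimage, SetLike.mem_coe,
      Subgroup.mem_centralizer_singleton_iff]
    exact (h v).symm.eq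
  rw [PresentedGroup.closure_range_of] at h1
  have := h1 (Subgroup.mem_top a)
  rw [Subgroup.mem_comap, Subgroup.mem_centralizer_singleton_iff] at this
  exact Commute.symm this

lemma T_subsingleton {V : Type*} [Subsingleton V] (Γ : SimpleGraph V) : T (RAAG Γ) := by
  have h : ∀ a b : RAAG Γ, Commute a b := by
    intro a b
    refine raag_comm_all (MonoidHom.id _) a (fun v => ?_) b
    refine Commute.symm (raag_comm_all (MonoidHom.id _) _ (fun w => ?_) a)
    rw [Subsingleton.elim v w]
  exact fun f => base1 f one_ne_zero one_ne_zero (h _ _)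

/-- The fibre of a colouring. -/
abbrev Fib {V : Type*} (Γ : SimpleGraph V) (c : V → Bool) (b : Bool) :
    SimpleGraph {v // c v = b} := Γ.comap Subtype.val

/-- Inclusion of a fibre. -/
def fibIncl {V : Type*} (Γ : SimpleGraph V) (c : V → Bool) (b : Bool) : RAAG (Fib Γ c b) →* RAAG Γ :=
  raagLift (fun v => PresentedGroup.of v.1) (fun _ _ h => raag_comm h)

lemma T_free {V : Type*} (Γ : SimpleGraph V) (c : V → Bool)
    (hc : ∀ u v, Γ.Adj u v → c u = c v) (h : ∀ b, T (RAAG (Fib Γ c b))) : T (RAAG Γ) := by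
  have aux : ∀ (u v : V) (b b' : Bool) (hu : c u = b) (hv : c v = b'), b = b' → Γ.Adj u v →
      Commute (CoprodI.of (M := fun b => RAAG (Fib Γ c b)) (i := b) (PresentedGroup.of ⟨u, hu⟩))
        (CoprodI.of (M := fun b => RAAG (Fib Γ c b)) (i := b') (PresentedGroup.of ⟨v, hv⟩)) := by
    rintro u v b b' hu hv rfl huv
    exact Commute.map (raag_comm (Γ := Fib Γ c b) (u := ⟨u, hu⟩) (v := ⟨v, hv⟩) huv) _
  let φ : RAAG Γ →* CoprodI (fun b => RAAG (Fib Γ c b)) :=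
    raagLift (fun v => CoprodI.of (M := fun b => RAAG (Fib Γ c b)) (i := c v)
      (PresentedGroup.of ⟨v, rfl⟩)) (fun u v huv => aux u v _ _ rfl rfl (hc u v huv) huv)
  let ψ : CoprodI (fun b => RAAG (Fib Γ c b)) →* RAAG Γ := CoprodI.lift (fun b => fibIncl Γ c b)
  have hψ : ψ.comp φ = MonoidHom.id _ := by
    apply PresentedGroup.ext
    intro v
    simp [φ, ψ, fibIncl]
  refine (T.coprodI h).of_injective φ ?_
  exact Function.LeftInverse.injective (g := ψ) fun a => DFunLike.congr_fun hψ a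

lemma T_join {V : Type*} (Γ : SimpleGraph V) (c : V → Bool)
    (hc : ∀ u v, c u ≠ c v → Γ.Adj u v) (h : ∀ b, T (RAAG (Fib Γ c b))) : T (RAAG Γ) := by
  let φ : RAAG Γ →* RAAG (Fib Γ c true) × RAAG (Fib Γ c false) :=
    raagLift (fun v => if hv : c v = true then (PresentedGroup.of ⟨v, hv⟩, 1)
      else (1, PresentedGroup.of ⟨v, by simpa using hv⟩)) (by
      intro u v huv
      by_cases hu : c u = true <;> by_cases hv : c v = true
      · simp only [hu, hv, dite_true]
        exact Commute.prod (raag_comm (Γ := Fib Γ c true) huv) (Commute.one_left _)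
      · simp only [hu, hv, dite_true]
        exact Commute.prod (Commute.one_right _) (Commute.one_left _)
      · simp only [hu, hv, dite_true]
        exact Commute.prod (Commute.one_left _) (Commute.one_right _)
      · simp only [hu, hv]
        exact Commute.prod (Commute.one_left _) (raag_comm (Γ := Fib Γ c false) huv))
  have hcomm : ∀ a b, Commute (fibIncl Γ c true a) (fibIncl Γ c false b) := by
    intro a b
    refine raag_comm_all _ _ (fun v => ?_) b
    refine Commute.symm (raag_comm_all _ _ (fun u => ?_) a)
    simp only [fibIncl, raagLift_of]
    apply raag_comm
    exact hc _ _ (by rw [u.2, v.2]; simp)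
  let ψ : RAAG (Fib Γ c true) × RAAG (Fib Γ c false) →* RAAG Γ :=
    MonoidHom.noncommCoprod (fibIncl Γ c true) (fibIncl Γ c false) hcomm
  have hψ : ψ.comp φ = MonoidHom.id _ := by
    apply PresentedGroup.ext
    intro v
    by_cases hv : c v = true
    · simp [φ, ψ, fibIncl, hv]
    · simp [φ, ψ, fibIncl, hv]
  refine ((h true).prod (h false)).of_injective φ ?_
  exact Function.LeftInverse.injective (g := ψ) fun a => DFunLike.congr_fun hψ a

lemma T_raag (n : ℕ) {V : Type*} [Fintype V] (Γ : SimpleGraph V) (h : NoP Γ)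
    (hn : Fintype.card V ≤ n) : T (RAAG Γ) := by
  classical
  induction n generalizing V with
  | zero =>
    have : Subsingleton V := Fintype.card_le_one_iff_subsingleton.1 (by omega)
    exact T_subsingleton Γ
  | succ n ih =>
    by_cases h1 : Fintype.card V ≤ 1
    · have : Subsingleton V := Fintype.card_le_one_iff_subsingleton.1 h1
      exact T_subsingleton Γ
    have key : ∀ U : Set V, (∃ a, a ∈ U) → (∃ b, b ∉ U) →
        ∀ b, T (RAAG (Fib Γ (fun v => decide (v ∈ U)) b)) := by
      rintro U ⟨a0, ha0⟩ ⟨b0, hb0⟩ b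
      apply ih
      · intro a b c d hab hbc hcd hac hbd had nac nbd nad
        exact h a.1 b.1 c.1 d.1 hab hbc hcd hac hbd had (fun e => nac (Subtype.ext e))
          (fun e => nbd (Subtype.ext e)) (fun e => nad (Subtype.ext e))
      · have : Fintype.card {v // decide (v ∈ U) = b} < Fintype.card V := by
          cases b
          · exact Fintype.card_subtype_lt (x := a0) (by simpa using ha0)
          · exact Fintype.card_subtype_lt (x := b0) (by simpa using hb0)
        omega
    rcases seinsche h Finset.univ (by rw [Finset.card_univ]; omega) with hs | hs
    · obtain ⟨U, ⟨a0, -, ha0⟩, ⟨b0, -, hb0⟩, hU⟩ := hs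
      refine T_free Γ _ ?_ (key U ⟨a0, ha0⟩ ⟨b0, hb0⟩)
      intro u v huv
      by_cases hu : u ∈ U <;> by_cases hv : v ∈ U
      · simp [hu, hv]
      · exact absurd huv (hU u (by simp) v (by simp) hu hv)
      · exact absurd huv.symm (hU v (by simp) u (by simp) hv hu)
      · simp [hu, hv]
    · obtain ⟨U, ⟨a0, -, ha0⟩, ⟨b0, -, hb0⟩, hU⟩ := hs
      refine T_join Γ _ ?_ (key U ⟨a0, ha0⟩ ⟨b0, hb0⟩)
      intro u v huv
      have hne : u ≠ v := by rintro rfl; exact huv rfl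
      by_contra hadj
      by_cases hu : u ∈ U <;> by_cases hv : v ∈ U
      · simp [hu, hv] at huv
      · exact hU u (by simp) v (by simp) hu hv ⟨hne, hadj⟩
      · exact hU v (by simp) u (by simp) hv hu ⟨hne.symm, fun e => hadj e.symm⟩
      · simp [hu, hv] at huv

lemma hasP4_of_not_noP {V : Type*} {Γ : SimpleGraph V} (h : ¬ NoP Γ) : HasInducedP4 Γ := by
  unfold NoP at h
  push Not at h
  obtain ⟨a, b, c, d, hab, hbc, hcd, hac, hbd, had, nac, nbd, nad, -⟩ := h
  refine ⟨![a, b, c, d], ?_, ?_⟩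
  · have := hab.ne
    have := hbc.ne
    have := hcd.ne
    intro i j hij
    fin_cases i <;> fin_cases j <;> simp_all
  · intro i j
    rw [pathAdj]
    have hba := hab.symm
    have hcb := hbc.symm
    have hdc := hcd.symm
    have hca : ¬ Γ.Adj c a := fun e => hac e.symm
    have hdb : ¬ Γ.Adj d b := fun e => hbd e.symm
    have hda : ¬ Γ.Adj d a := fun e => had e.symm
    fin_cases i <;> fin_cases j <;> simp_all

end final
end KK

/-- Kim–Koberda. If `A(P₄)` embeds into a right-angled Artin group `A(Γ)`,
then `Γ` contains `P₄` as an induced subgraph. -/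
theorem stmt_14 {V : Type*} [Fintype V] (Γ : SimpleGraph V)
    (f : RAAG (SimpleGraph.pathGraph 4) →* RAAG Γ) (hf : Function.Injective f) :
    HasInducedP4 Γ := by
  by_contra h
  have hN : KK.NoP Γ := by
    by_contra hN
    exact h (KK.hasP4_of_not_noP hN)
  exact (KK.T_raag _ Γ hN le_rfl).not_injective f hf
end

section
/- (Metaftsis–Raptis.) A right-angled Artin group A(Γ) is subgroup separable if and only if the finite simplicial graph Γ contains neither P_4 nor C_4 as an induced subgraph. -/
/-- A group `G` is subgroup separable if every finitely generated subgroup of `G` is an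
intersection of finite-index subgroups of `G`. -/
def SubgroupSeparable (G : Type*) [Group G] : Prop :=
  ∀ H : Subgroup G, H.FG →
    ∃ S : Set (Subgroup G), (∀ K ∈ S, K.FiniteIndex) ∧ H = sInf S

/-- The simplicial graph `Γ` contains the cycle `C₄` on four vertices as an induced
subgraph. -/
def HasInducedC4 {V : Type*} (Γ : SimpleGraph V) : Prop :=
  ∃ φ : Fin 4 → V, Function.Injective φ ∧
    ∀ i j, Γ.Adj (φ i) (φ j) ↔ (SimpleGraph.cycleGraph 4).Adj i j


/-! ## Forward direction: the obstruction -/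

theorem mr_criterion {V : Type*} {Γ : SimpleGraph V} (h : SubgroupSeparable (RAAG Γ))
    {X : Type*} (ρ : RAAG Γ →* Equiv.Perm X) (x : X) (l : Finset (RAAG Γ))
    (hl : ∀ k ∈ l, ρ k x = x) (g : RAAG Γ) (hg : ρ g x ≠ x) :
    ∃ (K : Subgroup (RAAG Γ)) (τ : RAAG Γ →* Equiv.Perm (RAAG Γ ⧸ K)) (y : RAAG Γ ⧸ K),
      Finite (RAAG Γ ⧸ K) ∧ (∀ k ∈ l, τ k y = y) ∧ τ g y ≠ y := by
  obtain ⟨S, hS, hH⟩ := h (Subgroup.closure (l : Set (RAAG Γ))) ⟨l, rfl⟩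
  have hgn : g ∉ Subgroup.closure (l : Set (RAAG Γ)) := by
    intro hmem
    apply hg
    have hle : Subgroup.closure (l : Set (RAAG Γ)) ≤
        (MulAction.stabilizer (Equiv.Perm X) x).comap ρ := by
      rw [Subgroup.closure_le]
      intro k hk
      exact hl k hk
    exact hle hmem
  rw [hH, Subgroup.mem_sInf] at hgn
  push Not at hgn
  obtain ⟨K, hK, hgK⟩ := hgn
  have hle : Subgroup.closure (l : Set (RAAG Γ)) ≤ K := by
    rw [hH]; exact sInf_le hK
  have := hS K hK
  refine ⟨K, MulAction.toPermHom _ _, ((1 : RAAG Γ) : RAAG Γ ⧸ K), inferInstance, ?_, ?_⟩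
  · intro k hk
    have hkK : k ∈ K := hle (Subgroup.subset_closure hk)
    change ((k * 1 : RAAG Γ) : RAAG Γ ⧸ K) = _
    rw [eq_comm, QuotientGroup.eq]
    simpa using hkK
  · intro he
    change ((g * 1 : RAAG Γ) : RAAG Γ ⧸ K) = _ at he
    rw [eq_comm, QuotientGroup.eq] at he
    exact hgK (by simpa using he)

theorem mr_lift {V : Type*} {Γ : SimpleGraph V} {M : Type*} [Group M] (σ : V → M)
    (hσ : ∀ u v, Γ.Adj u v → Commute (σ u) (σ v)) :
    ∃ ρ : RAAG Γ →* M, ∀ v, ρ (PresentedGroup.of v) = σ v := by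
  refine ⟨PresentedGroup.toGroup (f := σ) ?_, fun v => PresentedGroup.toGroup.of _⟩
  rintro r ⟨u, v, huv, rfl⟩
  have := hσ u v huv
  simp only [map_mul, map_inv, FreeGroup.lift_apply_of]
  rw [this.eq]
  group

theorem mr_commute {V : Type*} {Γ : SimpleGraph V} {u v : V} (h : Γ.Adj u v) :
    Commute (PresentedGroup.of u : RAAG Γ) (PresentedGroup.of v) := by
  have : (PresentedGroup.mk (raagRels Γ)) (FreeGroup.of u * FreeGroup.of v *
      (FreeGroup.of u)⁻¹ * (FreeGroup.of v)⁻¹) = 1 :=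
    PresentedGroup.one_of_mem ⟨u, v, h, rfl⟩
  simp only [map_mul, map_inv] at this
  change (PresentedGroup.of u : RAAG Γ) * (PresentedGroup.of v) *
    (PresentedGroup.of u)⁻¹ * (PresentedGroup.of v)⁻¹ = 1 at this
  rw [mul_inv_eq_one, mul_inv_eq_iff_eq_mul] at this
  exact this

theorem mr_lift_four {V : Type*} {Γ : SimpleGraph V} {G4 : SimpleGraph (Fin 4)}
    (φ : Fin 4 → V) (hφ : Function.Injective φ) (hA : ∀ i j, Γ.Adj (φ i) (φ j) ↔ G4.Adj i j)
    {M : Type*} [Group M] (p : Fin 4 → M) (hp : ∀ i j, G4.Adj i j → Commute (p i) (p j)) :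
    ∃ ρ : RAAG Γ →* M, ∀ i, ρ (PresentedGroup.of (φ i)) = p i := by
  obtain ⟨ρ, hρ⟩ := mr_lift (Γ := Γ) (Function.extend φ p (fun _ => 1)) (by
    intro u v huv
    by_cases hu : ∃ i, φ i = u
    · by_cases hv : ∃ i, φ i = v
      · obtain ⟨i, rfl⟩ := hu
        obtain ⟨j, rfl⟩ := hv
        rw [hφ.extend_apply, hφ.extend_apply]
        exact hp i j ((hA i j).1 huv)
      · rw [Function.extend_apply' _ _ v hv]
        exact Commute.one_right _
    · rw [Function.extend_apply' _ _ u hu]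
      exact Commute.one_left _)
  exact ⟨ρ, fun i => by rw [hρ, hφ.extend_apply]⟩

/-! ### The path `P₄` -/

def mrB : Equiv.Perm (ℤ ⊕ ℤ) := Equiv.sumCongr (Equiv.addRight 3) (Equiv.addRight 1)
def mrC : Equiv.Perm (ℤ ⊕ ℤ) := Equiv.sumCongr (Equiv.addRight 2) (Equiv.addRight 1)

/-- Swap the multiples of `k` in the left copy with the right copy. -/
def mrSwapFun (k : ℤ) : ℤ ⊕ ℤ → ℤ ⊕ ℤ
  | Sum.inl m => if m % k = 0 then Sum.inr (m / k) else Sum.inl m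
  | Sum.inr m => Sum.inl (k * m)

theorem mrSwapFun_invol (k : ℤ) (hk : k ≠ 0) (x : ℤ ⊕ ℤ) :
    mrSwapFun k (mrSwapFun k x) = x := by
  rcases x with m | m
  · by_cases h : m % k = 0
    · simp [mrSwapFun, h, Int.mul_ediv_cancel' (Int.dvd_of_emod_eq_zero h)]
    · simp [mrSwapFun, h]
  · simp [mrSwapFun, hk]

def mrA : Equiv.Perm (ℤ ⊕ ℤ) :=
  ⟨mrSwapFun 3, mrSwapFun 3, mrSwapFun_invol 3 (by norm_num), mrSwapFun_invol 3 (by norm_num)⟩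
def mrD : Equiv.Perm (ℤ ⊕ ℤ) :=
  ⟨mrSwapFun 2, mrSwapFun 2, mrSwapFun_invol 2 (by norm_num), mrSwapFun_invol 2 (by norm_num)⟩

theorem mrAB : Commute mrA mrB := by
  ext x
  rcases x with m | m
  · by_cases h : m % 3 = 0
    · have h' : (m + 3) / 3 = m / 3 + 1 := by omega
      simp [mrA, mrB, mrSwapFun, h, h']
    · simp [mrA, mrB, mrSwapFun, h]
  · simp [mrA, mrB, mrSwapFun]; ring

theorem mrCD : Commute mrC mrD := by
  ext x
  rcases x with m | m
  · by_cases h : m % 2 = 0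
    · have h' : (m + 2) / 2 = m / 2 + 1 := by omega
      simp [mrC, mrD, mrSwapFun, h, h']
    · simp [mrC, mrD, mrSwapFun, h]
  · simp [mrC, mrD, mrSwapFun]; ring

theorem mrBC : Commute mrB mrC := by
  ext x
  rcases x with m | m <;> simp [mrB, mrC]

/-- The finite obstruction for `P₄`. -/
theorem mr_P4_finite {Y : Type*} [Finite Y] (a b c d : Equiv.Perm Y)
    (hab : Commute a b) (hbc : Commute b c) (hcd : Commute c d) (x : Y)
    (h1 : (b ^ 2 * (c ^ 3)⁻¹) x = x) (h2 : (d⁻¹ * a) x = x) (h3 : (d⁻¹ * (b⁻¹ * c) * d) x = x) :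
    ((d * (b * c⁻¹))⁻¹ * (b⁻¹ * c) * (d * (b * c⁻¹))) x = x := by
  have hbc' : Commute b c⁻¹ := hbc.inv_right
  set e := b * c⁻¹ with he
  have hec : Commute e c := (hbc.mul_left ((Commute.refl c).inv_left))
  have heb : Commute e b := ((Commute.refl b).mul_left hbc.symm.inv_left)
  -- the relations, as membership in the stabilizer of `x`
  set St := MulAction.stabilizer (Equiv.Perm Y) x with hSt
  have hmem : ∀ g : Equiv.Perm Y, g ∈ St ↔ g x = x := fun g => Iff.rfl
  rw [← hmem] at h1 h2 h3 ⊢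
  have hb3 : b⁻¹ * e ^ 3 ∈ St := by
    have : b⁻¹ * e ^ 3 = b ^ 2 * (c ^ 3)⁻¹ := by
      rw [he, hbc'.mul_pow]; group
    rwa [this]
  have hc2 : c⁻¹ * e ^ 2 ∈ St := by
    have : c⁻¹ * e ^ 2 = b ^ 2 * (c ^ 3)⁻¹ := by
      rw [he, hbc'.mul_pow, ← mul_assoc, ← (hbc'.pow_left 2).eq]; group
    rwa [this]
  -- exponents of `b` and `c`
  have hcn : ∀ n : ℕ, (c ^ n)⁻¹ * e ^ (2 * n) ∈ St := by
    intro n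
    have : (c ^ n)⁻¹ * e ^ (2 * n) = (c⁻¹ * e ^ 2) ^ n := by
      rw [((hec.symm.inv_left).pow_right 2).mul_pow, inv_pow, pow_mul]
    rw [this]; exact St.pow_mem hc2 n
  have hda : ∀ n : ℕ, c ^ n ∈ St ↔ b ^ n ∈ St := by
    intro n
    have k1 : (d⁻¹ * (b⁻¹ * c) * d) ^ n = d⁻¹ * (b ^ n)⁻¹ * d * c ^ n := by
      have : (d⁻¹ * (b⁻¹ * c) * d) ^ n = d⁻¹ * (b⁻¹ * c) ^ n * d := by
        have := conj_pow (i := n) (a := d⁻¹) (b := b⁻¹ * c)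
        simpa using this
      rw [this, (hbc.inv_left).mul_pow, inv_pow, mul_assoc, mul_assoc, (hcd.pow_left n).eq]
      group
    have k2 : d⁻¹ * (b ^ n)⁻¹ * d * c ^ n ∈ St := k1 ▸ St.pow_mem h3 n
    have k3 : d⁻¹ * (b ^ n)⁻¹ * d = (d⁻¹ * a) * (b ^ n)⁻¹ * (d⁻¹ * a)⁻¹ := by
      have : a * (b ^ n)⁻¹ * a⁻¹ = (b ^ n)⁻¹ := by
        rw [((hab.pow_right n).inv_right).eq]; group
      calc d⁻¹ * (b ^ n)⁻¹ * d = d⁻¹ * (a * (b ^ n)⁻¹ * a⁻¹) * d := by rw [this]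
        _ = _ := by group
    rw [k3] at k2
    constructor
    · intro hc
      have := (St.mul_mem_cancel_right hc).1 k2
      have := (St.mul_mem_cancel_right (St.inv_mem h2)).1 this
      have := (St.mul_mem_cancel_left h2).1 this
      exact (St.inv_mem_iff).1 this
    · intro hb
      exact (St.mul_mem_cancel_left
        (St.mul_mem (St.mul_mem h2 (St.inv_mem hb)) (St.inv_mem h2))).1 k2
  -- minimal exponent
  have hex : ∃ n : ℕ, 0 < n ∧ c ^ n ∈ St :=
    ⟨orderOf c, orderOf_pos c, by rw [pow_orderOf_eq_one]; exact St.one_mem⟩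
  classical
  obtain ⟨hm0, hmc⟩ := Nat.find_spec hex
  have hmin : ∀ k, 0 < k → c ^ k ∈ St → Nat.find hex ≤ k := fun k h h' => Nat.find_min' hex ⟨h, h'⟩
  generalize Nat.find hex = m at hm0 hmc hmin
  have hem : e ^ m ∈ St := by
    rw [he, hbc'.mul_pow, inv_pow]
    exact St.mul_mem ((hda m).1 hmc) (St.inv_mem hmc)
  rcases Nat.even_or_odd' m with ⟨j, rfl | rfl⟩
  · have := hcn j
    have := (St.mul_mem_cancel_right hem).1 this
    have := hmin j (by omega) ((St.inv_mem_iff).1 this)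
    omega
  · have k := hcn (j + 1)
    have k' : (c ^ (j + 1))⁻¹ * e ^ (2 * (j + 1)) = (c ^ (j + 1))⁻¹ * e * e ^ (2 * j + 1) := by
      rw [mul_assoc, ← pow_succ']
      rfl
    rw [k'] at k
    have k := (St.mul_mem_cancel_right hem).1 k
    set s := (c ^ (j + 1))⁻¹ * e with hs
    have hes : e = c ^ (j + 1) * s := by rw [hs]; group
    have : (d * e)⁻¹ * (b⁻¹ * c) * (d * e) = s⁻¹ * (d⁻¹ * (b⁻¹ * c) * d) * s := by
      have q1 : d * e = c ^ (j + 1) * d * s := by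
        rw [hes, (hcd.pow_left (j+1)).eq]; group
      have q2 : Commute (b⁻¹ * c) (c ^ (j + 1)) :=
        (hbc.inv_left.mul_left (Commute.refl c)).pow_right _
      rw [q1]
      calc _ = s⁻¹ * d⁻¹ * (c ^ (j+1))⁻¹ * ((b⁻¹ * c) * c ^ (j+1)) * d * s := by group
        _ = _ := by rw [q2.eq]; group
    rw [this]
    exact St.mul_mem (St.mul_mem (St.inv_mem k) h3) k

theorem mr_not_P4 {V : Type*} {Γ : SimpleGraph V} (h : SubgroupSeparable (RAAG Γ)) :
    ¬ HasInducedP4 Γ := by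
  rintro ⟨φ, hφ, hA⟩
  obtain ⟨ρ, hρ⟩ := mr_lift_four φ hφ hA ![mrA, mrB, mrC, mrD] (by
    intro i j hij
    rw [SimpleGraph.pathGraph_adj] at hij
    fin_cases i <;> fin_cases j <;> simp at hij ⊢ <;>
      first
      | exact mrAB | exact mrAB.symm | exact mrBC | exact mrBC.symm | exact mrCD
      | exact mrCD.symm)
  classical
  have ha := hρ 0
  have hb := hρ 1
  have hc := hρ 2
  have hd := hρ 3
  simp only [Matrix.cons_val] at ha hb hc hd
  have cab := mr_commute ((hA 0 1).2 (by rw [SimpleGraph.pathGraph_adj]; simp))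
  have cbc := mr_commute ((hA 1 2).2 (by rw [SimpleGraph.pathGraph_adj]; simp))
  have ccd := mr_commute ((hA 2 3).2 (by rw [SimpleGraph.pathGraph_adj]; simp))
  generalize (PresentedGroup.of (φ 0) : RAAG Γ) = a at *
  generalize (PresentedGroup.of (φ 1) : RAAG Γ) = b at *
  generalize (PresentedGroup.of (φ 2) : RAAG Γ) = c at *
  generalize (PresentedGroup.of (φ 3) : RAAG Γ) = d at *
  obtain ⟨K, τ, y, hfin, hy, hgy⟩ := mr_criterion h ρ (Sum.inl 0)
    {b ^ 2 * (c ^ 3)⁻¹, d⁻¹ * a, d⁻¹ * (b⁻¹ * c) * d} (by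
      intro k hk
      simp only [Finset.mem_insert, Finset.mem_singleton] at hk
      rcases hk with rfl | rfl | rfl
      · simp only [map_mul, map_pow, map_inv, hb, hc]
        have : (mrC ^ 3 : Equiv.Perm (ℤ ⊕ ℤ)) (Sum.inl (-6)) = Sum.inl 0 := by
          simp [mrC, pow_succ]
        rw [Equiv.Perm.mul_apply, Equiv.Perm.inv_eq_iff_eq.2 this.symm]
        simp [mrB, pow_succ]
      · simp only [map_mul, map_inv, ha, hd]
        rw [Equiv.Perm.mul_apply, Equiv.Perm.inv_eq_iff_eq]
        simp [mrA, mrD, mrSwapFun]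
      · simp only [map_mul, map_inv, hb, hc, hd]
        rw [Equiv.Perm.mul_apply, Equiv.Perm.mul_apply, Equiv.Perm.inv_eq_iff_eq,
          Equiv.Perm.mul_apply, Equiv.Perm.inv_eq_iff_eq]
        simp [mrB, mrC, mrD, mrSwapFun])
    ((d * (b * c⁻¹))⁻¹ * (b⁻¹ * c) * (d * (b * c⁻¹))) (by
      simp only [map_mul, map_inv, hb, hc, hd]
      have h1 : (mrD * (mrB * mrC⁻¹)) (Sum.inl 0) = Sum.inl 1 := by
        have : (mrC : Equiv.Perm (ℤ ⊕ ℤ)) (Sum.inl (-2)) = Sum.inl 0 := by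
          simp [mrC]
        rw [Equiv.Perm.mul_apply, Equiv.Perm.mul_apply, Equiv.Perm.inv_eq_iff_eq.2 this.symm]
        simp [mrD, mrB, mrSwapFun]
      rw [Equiv.Perm.mul_apply, Equiv.Perm.mul_apply, Ne, Equiv.Perm.inv_eq_iff_eq, h1,
        Equiv.Perm.mul_apply, Equiv.Perm.inv_eq_iff_eq]
      simp [mrB, mrC])
  apply hgy
  have r1 := hy (b ^ 2 * (c ^ 3)⁻¹) (by simp)
  have r2 := hy (d⁻¹ * a) (by simp)
  have r3 := hy (d⁻¹ * (b⁻¹ * c) * d) (by simp)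
  have := mr_P4_finite (τ a) (τ b) (τ c) (τ d) (cab.map τ) (cbc.map τ) (ccd.map τ) y
    (by simpa only [map_mul, map_inv, map_pow] using r1)
    (by simpa only [map_mul, map_inv, map_pow] using r2)
    (by simpa only [map_mul, map_inv, map_pow] using r3)
  simpa only [map_mul, map_inv, map_pow] using this

/-! ### The cycle `C₄` -/

/-- In a finite group, the Baumslag–Solitar relation forces commutation. -/
theorem mr_BS_finite {G : Type*} [Group G] [Finite G] (A T : G)
    (h : T * A ^ 2 * T⁻¹ = A ^ 3) : Commute (T * A * T⁻¹) A := by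
  have ho : orderOf (A ^ 2) = orderOf (A ^ 3) := by
    rw [← h]
    exact (orderOf_injective (MulAut.conj T).toMonoidHom (MulAut.conj T).injective (A ^ 2)).symm
  rw [orderOf_pow, orderOf_pow] at ho
  have hpos := orderOf_pos A
  have e2 := Nat.div_mul_cancel (Nat.gcd_dvd_left (orderOf A) 2)
  have e3 := Nat.div_mul_cancel (Nat.gcd_dvd_left (orderOf A) 3)
  have hq : 0 < orderOf A / (orderOf A).gcd 2 :=
    Nat.div_pos (Nat.le_of_dvd hpos (Nat.gcd_dvd_left _ _)) (Nat.gcd_pos_of_pos_left _ hpos)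
  have hg : (orderOf A).gcd 2 = (orderOf A).gcd 3 := by
    rw [← ho] at e3
    exact Nat.eq_of_mul_eq_mul_left hq (e2.trans e3.symm)
  have hcop : (orderOf A).gcd 2 = 1 := by
    have d2 : (orderOf A).gcd 2 ∣ 2 := Nat.gcd_dvd_right _ _
    have d3 : (orderOf A).gcd 2 ∣ 3 := hg ▸ Nat.gcd_dvd_right _ _
    have := Nat.dvd_gcd d2 d3
    simpa using this
  obtain ⟨k, hk⟩ := exists_pow_eq_self_of_coprime (Nat.Coprime.symm hcop)
  have : T * A * T⁻¹ = (A ^ 3) ^ k := by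
    rw [← h, conj_pow, hk]
  rw [this]
  exact ((Commute.refl A).pow_left 3).pow_left k

def mrShift : Equiv.Perm (ℤ × ℤ) where
  toFun p := (p.1 + 1, p.2)
  invFun p := (p.1 - 1, p.2)
  left_inv p := by simp
  right_inv p := by simp

def mrT : Equiv.Perm (ℤ × ℤ) where
  toFun p := (3 * (p.1 / 2) + (2 * p.2 + p.1 % 2) % 3, (2 * p.2 + p.1 % 2) / 3)
  invFun p := (2 * (p.1 / 3) + (3 * p.2 + p.1 % 3) % 2, (3 * p.2 + p.1 % 3) / 2)
  left_inv p := by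
    ext <;> dsimp only <;> omega
  right_inv p := by
    ext <;> dsimp only <;> omega

theorem mrT_rel : mrT * mrShift ^ 2 * mrT⁻¹ = mrShift ^ 3 := by
  rw [mul_inv_eq_iff_eq_mul]
  apply Equiv.ext
  intro p
  simp only [pow_succ, pow_zero, one_mul, Equiv.Perm.mul_apply]
  ext <;> simp [mrT, mrShift] <;> omega

theorem mrT_not_commute : ¬ Commute (mrT * mrShift * mrT⁻¹) mrShift := by
  intro h
  have h1 := congrArg (fun f : Equiv.Perm (ℤ × ℤ) => f (0, 0)) h.eq
  have k0 : mrT (0, 0) = (0, 0) := by simp [mrT]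
  have k1 : mrT (1, 0) = (1, 0) := by simp [mrT]
  simp only [Equiv.Perm.mul_apply] at h1
  have s0 : mrShift (0, 0) = (1, 0) := by simp [mrShift]
  rw [s0, Equiv.Perm.inv_eq_iff_eq.2 k0.symm, Equiv.Perm.inv_eq_iff_eq.2 k1.symm, s0, k1] at h1
  simp [mrT, mrShift] at h1

/-- The finite obstruction for `C₄`. -/
theorem mr_C4_finite {Y : Type*} [Finite Y] (a t a' t' : Equiv.Perm Y)
    (haa : Commute a a') (hat : Commute a t') (hta : Commute t a') (htt : Commute t t') (x : Y)
    (h1 : (a * a') x = x) (h2 : (t * t') x = x) (h3 : (t * a ^ 2 * t⁻¹ * (a ^ 3)⁻¹) x = x) :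
    (t * a * t⁻¹ * a * (t * a * t⁻¹)⁻¹ * a⁻¹) x = x := by
  set N := Subgroup.closure ({a', t'} : Set (Equiv.Perm Y)) with hN
  have hcent : ∀ g ∈ N, Commute a g ∧ Commute t g := by
    intro g hg
    induction hg using Subgroup.closure_induction with
    | mem g hg =>
      rcases hg with rfl | rfl
      · exact ⟨haa, hta⟩
      · exact ⟨hat, htt⟩
    | one => exact ⟨Commute.one_right _, Commute.one_right _⟩
    | mul g k _ _ hg hk => exact ⟨hg.1.mul_right hk.1, hg.2.mul_right hk.2⟩
    | inv g _ hg => exact ⟨hg.1.inv_right, hg.2.inv_right⟩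
  have ha'N : a' ∈ N := Subgroup.subset_closure (by simp)
  have ht'N : t' ∈ N := Subgroup.subset_closure (by simp)
  let P : Y → Prop := fun z => ∃ g ∈ N, g x = z
  have gen : ∀ s s' : Equiv.Perm Y, s' ∈ N → (∀ g ∈ N, Commute s g) → (s * s') x = x →
      ∀ z, P (s z) ↔ P z := by
    intro s s' hs' hs hx z
    have e1 : s x = s'⁻¹ x := by
      have : (s' * s) x = x := by rw [← (hs s' hs').eq]; exact hx
      rw [eq_comm, Equiv.Perm.inv_eq_iff_eq]; exact this.symm
    constructor
    · rintro ⟨g, hg, hgz⟩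
      refine ⟨g * s', N.mul_mem hg hs', ?_⟩
      apply s.injective
      rw [← hgz, ← Equiv.Perm.mul_apply, ← mul_assoc, (hs g hg).eq, mul_assoc,
        Equiv.Perm.mul_apply, hx]
    · rintro ⟨g, hg, rfl⟩
      refine ⟨g * s'⁻¹, N.mul_mem hg (N.inv_mem hs'), ?_⟩
      rw [Equiv.Perm.mul_apply, ← e1, ← Equiv.Perm.mul_apply, ← (hs g hg).eq]
      rfl
  have Pa := gen a a' ha'N (fun g hg => (hcent g hg).1) h1
  have Pt := gen t t' ht'N (fun g hg => (hcent g hg).2) h2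
  let A : Equiv.Perm {z // P z} := a.subtypePerm Pa
  let T : Equiv.Perm {z // P z} := t.subtypePerm Pt
  have hrel : T * A ^ 2 * T⁻¹ * (A ^ 3)⁻¹ = 1 := by
    apply Equiv.ext
    rintro ⟨z, g, hg, rfl⟩
    apply Subtype.ext
    have hr : Commute (t * a ^ 2 * t⁻¹ * (a ^ 3)⁻¹) g := by
      obtain ⟨c1, c2⟩ := hcent g hg
      exact ((c2.mul_left (c1.pow_left 2)).mul_left c2.inv_left).mul_left (c1.pow_left 3).inv_left
    have key : (t * a ^ 2 * t⁻¹ * (a ^ 3)⁻¹) (g x) = g x := by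
      rw [← Equiv.Perm.mul_apply, hr.eq, Equiv.Perm.mul_apply, h3]
    exact key
  have hcom := mr_BS_finite A T (mul_inv_eq_one.1 hrel)
  have hw : T * A * T⁻¹ * A * (T * A * T⁻¹)⁻¹ * A⁻¹ = 1 := by
    rw [hcom.eq]; group
  have := congrArg (fun f : Equiv.Perm {z // P z} => (f ⟨x, 1, N.one_mem, rfl⟩ : Y)) hw
  exact this

theorem mr_not_C4 {V : Type*} {Γ : SimpleGraph V} (h : SubgroupSeparable (RAAG Γ)) :
    ¬ HasInducedC4 Γ := by
  rintro ⟨φ, hφ, hA⟩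
  let L (g : Equiv.Perm (ℤ × ℤ)) : Equiv.Perm (Equiv.Perm (ℤ × ℤ)) := Equiv.mulLeft g
  let R (g : Equiv.Perm (ℤ × ℤ)) : Equiv.Perm (Equiv.Perm (ℤ × ℤ)) := Equiv.mulRight g⁻¹
  have LR : ∀ g k, Commute (L g) (R k) := by
    intro g k
    apply Equiv.ext
    intro z
    simp [L, R, mul_assoc]
  obtain ⟨ρ, hρ⟩ := mr_lift_four φ hφ hA ![L mrShift, R mrShift, L mrT, R mrT] (by
    intro i j hij
    rw [SimpleGraph.cycleGraph_adj] at hij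
    fin_cases i <;> fin_cases j <;>
      first
      | exact LR _ _ | exact (LR _ _).symm | (exfalso; revert hij; decide))
  classical
  have ha := hρ 0
  have ha' := hρ 1
  have ht := hρ 2
  have ht' := hρ 3
  simp only [Matrix.cons_val] at ha ha' ht ht'
  have c1 := mr_commute ((hA 0 1).2 (by rw [SimpleGraph.cycleGraph_adj]; decide))
  have c2 := mr_commute ((hA 0 3).2 (by rw [SimpleGraph.cycleGraph_adj]; decide))
  have c3 := mr_commute ((hA 2 1).2 (by rw [SimpleGraph.cycleGraph_adj]; decide))
  have c4 := mr_commute ((hA 2 3).2 (by rw [SimpleGraph.cycleGraph_adj]; decide))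
  generalize (PresentedGroup.of (φ 0) : RAAG Γ) = a at *
  generalize (PresentedGroup.of (φ 1) : RAAG Γ) = a' at *
  generalize (PresentedGroup.of (φ 2) : RAAG Γ) = t at *
  generalize (PresentedGroup.of (φ 3) : RAAG Γ) = t' at *
  have Lm : ∀ g k, L g * L k = L (g * k) := by
    intro g k; apply Equiv.ext; intro z; simp [L, mul_assoc]
  have Li : ∀ g, (L g)⁻¹ = L g⁻¹ := by
    intro g; apply Equiv.ext; intro z; simp [L]
  have Lp : ∀ g (n : ℕ), (L g) ^ n = L (g ^ n) := by
    intro g n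
    induction n with
    | zero => apply Equiv.ext; intro z; simp [L]
    | succ n ih => rw [pow_succ, ih, Lm, pow_succ]
  obtain ⟨K, τ, y, hfin, hy, hgy⟩ := mr_criterion h ρ 1
    {a * a', t * t', t * a ^ 2 * t⁻¹ * (a ^ 3)⁻¹} (by
      intro k hk
      simp only [Finset.mem_insert, Finset.mem_singleton] at hk
      rcases hk with rfl | rfl | rfl
      · simp only [map_mul, ha, ha']
        simp [L, R]
      · simp only [map_mul, ht, ht']
        simp [L, R]
      · simp only [map_mul, map_pow, map_inv, ha, ht, Lm, Li, Lp, mrT_rel]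
        simp [L])
    (t * a * t⁻¹ * a * (t * a * t⁻¹)⁻¹ * a⁻¹) (by
      simp only [map_mul, map_pow, map_inv, ha, ht, Lm, Li, Lp]
      intro he
      apply mrT_not_commute
      simp only [L, Equiv.coe_mulLeft] at he
      rw [mul_one, mul_inv_eq_one, mul_inv_eq_iff_eq_mul] at he
      exact he)
  apply hgy
  have r1 := hy (a * a') (by simp)
  have r2 := hy (t * t') (by simp)
  have r3 := hy (t * a ^ 2 * t⁻¹ * (a ^ 3)⁻¹) (by simp)
  have := mr_C4_finite (τ a) (τ t) (τ a') (τ t') (c1.map τ) (c2.map τ) (c3.map τ) (c4.map τ) y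
    (by simpa only [map_mul, map_inv, map_pow] using r1)
    (by simpa only [map_mul, map_inv, map_pow] using r2)
    (by simpa only [map_mul, map_inv, map_pow] using r3)
  simpa only [map_mul, map_inv, map_pow] using this
universe uV

/-! ## Backward direction: finite completions of partial actions -/

/-- Every finite piece of an action of the RAAG on `W` embeds in a finite action. -/
def MRComp {V : Type uV} (Γ : SimpleGraph V) (W : Finset V) : Prop :=
  ∀ (X : Type uV) (σ : V → Equiv.Perm X),
    (∀ a ∈ W, ∀ b ∈ W, Γ.Adj a b → Commute (σ a) (σ b)) → ∀ S : Finset X,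
    ∃ (Y : Type uV) (ι : X → Y) (τ : V → Equiv.Perm Y), Finite Y ∧
      Set.InjOn ι S ∧ (∀ a ∈ W, ∀ b ∈ W, Γ.Adj a b → Commute (τ a) (τ b)) ∧
      ∀ v ∈ W, ∀ s ∈ S, σ v s ∈ S → τ v (ι s) = ι (σ v s)

theorem mr_comp_empty {V : Type uV} (Γ : SimpleGraph V) : MRComp Γ ∅ := by
  classical
  intro X σ _ S
  refine ⟨Option S, fun x => if h : x ∈ S then some ⟨x, h⟩ else none, fun _ => 1,
    inferInstance, ?_, by simp, by simp⟩
  intro x hx y hy hxy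
  have hx' : x ∈ S := hx
  have hy' : y ∈ S := hy
  simpa [hx', hy'] using hxy

theorem mr_comp_union {V : Type uV} [DecidableEq V] (Γ : SimpleGraph V) (A B : Finset V)
    (hdis : Disjoint A B) (hno : ∀ a ∈ A, ∀ b ∈ B, ¬ Γ.Adj a b)
    (hA : MRComp Γ A) (hB : MRComp Γ B) : MRComp Γ (A ∪ B) := by
  intro X σ hσ S
  obtain ⟨Y1, ι1, τ1, hf1, hi1, hc1, he1⟩ := hA X σ (fun a ha b hb =>
    hσ a (Finset.mem_union_left _ ha) b (Finset.mem_union_left _ hb)) S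
  obtain ⟨Y2, ι2, τ2, hf2, hi2, hc2, he2⟩ := hB X σ (fun a ha b hb =>
    hσ a (Finset.mem_union_right _ ha) b (Finset.mem_union_right _ hb)) S
  obtain ⟨f, hf⟩ := Equiv.Perm.exists_extending_pair (α := S) (β := Y1 ⊕ Y2)
    (fun s => Sum.inl (ι1 s)) (fun s => Sum.inr (ι2 s))
    (fun s t h => Subtype.ext (hi1 s.2 t.2 (Sum.inl_injective h)))
    (fun s t h => Subtype.ext (hi2 s.2 t.2 (Sum.inr_injective h)))
  have hBA : ∀ b ∈ B, b ∉ A := fun b hb ha => (Finset.disjoint_left.1 hdis ha hb)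
  refine ⟨Y1 ⊕ Y2, fun x => Sum.inl (ι1 x), fun v => if v ∈ A then
    Equiv.Perm.sumCongr (τ1 v) 1 else f⁻¹ * Equiv.Perm.sumCongr 1 (τ2 v) * f,
    inferInstance, ?_, ?_, ?_⟩
  · intro x hx y hy hxy
    exact hi1 hx hy (Sum.inl_injective hxy)
  · intro a ha b hb hab
    rcases Finset.mem_union.1 ha with ha | ha <;> rcases Finset.mem_union.1 hb with hb | hb
    · simp only [ha, hb, if_true]
      have := (hc1 a ha b hb hab).eq
      rw [Commute, SemiconjBy, Equiv.Perm.sumCongr_mul, Equiv.Perm.sumCongr_mul, this]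
    · exact absurd hab (hno a ha b hb)
    · exact absurd hab.symm (hno b hb a ha)
    · simp only [hBA a ha, hBA b hb, if_false]
      have := (hc2 a ha b hb hab).eq
      have k : Commute (Equiv.Perm.sumCongr (1 : Equiv.Perm Y1) (τ2 a))
          (Equiv.Perm.sumCongr 1 (τ2 b)) := by
        rw [Commute, SemiconjBy, Equiv.Perm.sumCongr_mul, Equiv.Perm.sumCongr_mul, this]
      have k2 := k.conj f⁻¹
      simpa using k2
  · intro v hv s hs hvs
    rcases Finset.mem_union.1 hv with hv | hv
    · simp [hv, he1 v hv s hs hvs]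
    · simp only [hBA v hv, if_false, Equiv.Perm.mul_apply]
      rw [Equiv.Perm.inv_eq_iff_eq]
      have e1 := hf ⟨s, hs⟩
      have e2 := hf ⟨_, hvs⟩
      simp only at e1 e2
      rw [e1, e2]
      simp [he2 v hv s hs hvs]

theorem mr_pair_exponent {X : Type*} (Z : Equiv.Perm X) (s t : X) :
    ∃ n : ℕ, 0 < n ∧ ∀ k : ℤ, ((Z ^ n) ^ k) s = t → s = t := by
  by_cases hst : s = t
  · exact ⟨1, one_pos, fun _ _ => hst⟩
  by_cases hper : ∃ n : ℕ, 0 < n ∧ (Z ^ n) s = s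
  · obtain ⟨n, hn, h⟩ := hper
    refine ⟨n, hn, fun k hk => ?_⟩
    rw [← hk]
    exact (Equiv.Perm.zpow_apply_eq_self_of_apply_eq_self h k).symm
  by_cases hk : ∃ k : ℤ, (Z ^ k) s = t
  · obtain ⟨k, hk⟩ := hk
    refine ⟨k.natAbs + 1, Nat.succ_pos _, fun j hj => ?_⟩
    exfalso
    rw [← zpow_natCast, ← zpow_mul] at hj
    set q : ℤ := ((k.natAbs + 1 : ℕ) : ℤ) * j with hq
    have hfix : (Z ^ (q - k)) s = s := by
      have : Z ^ (q - k) = Z ^ (-k) * Z ^ q := by rw [← zpow_add]; congr 1; ring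
      rw [this, Equiv.Perm.mul_apply, hj, ← hk, zpow_neg]
      simp
    have hne : q - k ≠ 0 := by
      intro h0
      have hqk : q = k := by omega
      have hdvd : ((k.natAbs + 1 : ℕ) : ℤ) ∣ k := ⟨j, hqk.symm.trans hq⟩
      have hk0 : k = 0 := Int.eq_zero_of_abs_lt_dvd hdvd (by push_cast; omega)
      subst hk0
      exact hst (by simpa using hk)
    apply hper
    refine ⟨(q - k).natAbs, Int.natAbs_pos.2 hne, ?_⟩
    rcases Int.natAbs_eq (q - k) with h | h
    · rw [← zpow_natCast, ← h]; exact hfix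
    · rw [h, zpow_neg, Equiv.Perm.inv_eq_iff_eq, zpow_natCast] at hfix
      exact hfix.symm
  · exact ⟨1, one_pos, fun k h => absurd ⟨k, by simpa using h⟩ hk⟩

theorem mr_exponent {X : Type*} (Z : Equiv.Perm X) (S : Finset X) :
    ∃ n : ℕ, 0 < n ∧ ∀ s ∈ S, ∀ t ∈ S, ∀ k : ℤ, ((Z ^ n) ^ k) s = t → s = t := by
  choose N hN0 hN using fun s t => mr_pair_exponent Z s t
  refine ⟨∏ p ∈ S ×ˢ S, N p.1 p.2, Finset.prod_pos fun p _ => hN0 _ _, ?_⟩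
  intro s hs t ht k hk
  obtain ⟨m, hm⟩ := Finset.dvd_prod_of_mem (fun p : X × X => N p.1 p.2)
    (Finset.mk_mem_product hs ht)
  apply hN s t (m * k)
  rw [hm] at hk
  rw [zpow_mul, zpow_natCast, ← pow_mul]
  exact hk

theorem mr_comp_cone {V : Type uV} [DecidableEq V] (Γ : SimpleGraph V) (W : Finset V) (z : V)
    (hzW : z ∉ W) (hadj : ∀ w ∈ W, Γ.Adj z w)
    (hW : MRComp Γ W) : MRComp Γ (insert z W) := by
  classical
  intro X σ hσ S
  obtain ⟨n, hn, hsep⟩ := mr_exponent (σ z) S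
  have : NeZero n := ⟨hn.ne'⟩
  have hzc : ∀ v ∈ insert z W, Commute (σ v) (σ z) := by
    intro v hv
    rcases Finset.mem_insert.1 hv with rfl | hv'
    · exact Commute.refl _
    · exact (hσ z (Finset.mem_insert_self _ _) v hv (hadj v hv')).symm
  let r : Setoid X :=
    { r := fun x y => ∃ k : ℤ, ((σ z ^ n) ^ k) x = y
      iseqv := ⟨fun x => ⟨0, by simp⟩, by
        rintro x y ⟨k, rfl⟩
        exact ⟨-k, by simp [zpow_neg]⟩, by
        rintro x y w ⟨k, rfl⟩ ⟨j, rfl⟩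
        exact ⟨j + k, by rw [zpow_add, Equiv.Perm.mul_apply]⟩⟩ }
  have hcongr : ∀ g : Equiv.Perm X, Commute g (σ z) → ∀ x y, r x y ↔ r (g x) (g y) := by
    intro g hg x y
    have hk : ∀ k : ℤ, ((σ z ^ n) ^ k) (g x) = g (((σ z ^ n) ^ k) x) := by
      intro k
      rw [← Equiv.Perm.mul_apply, ← ((hg.pow_right n).zpow_right k).eq]
      rfl
    constructor
    · rintro ⟨k, rfl⟩
      exact ⟨k, hk k⟩
    · rintro ⟨k, h⟩
      refine ⟨k, g.injective ?_⟩
      rw [← hk k, h]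
  let q : X → Quotient r := Quotient.mk r
  let σ' : V → Equiv.Perm (Quotient r) := fun v =>
    if h : Commute (σ v) (σ z) then Quotient.congr (σ v) (hcongr (σ v) h) else 1
  have hσ' : ∀ v ∈ insert z W, ∀ x, σ' v (q x) = q (σ v x) := by
    intro v hv x
    simp only [σ', hzc v hv, dif_pos]
    rfl
  have hcomm' : ∀ a ∈ insert z W, ∀ b ∈ insert z W, Commute (σ a) (σ b) →
      Commute (σ' a) (σ' b) := by
    intro a ha b hb hab
    apply Equiv.ext
    intro x
    obtain ⟨x, rfl⟩ := Quotient.exists_rep x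
    change σ' a (σ' b (q x)) = σ' b (σ' a (q x))
    rw [hσ' b hb, hσ' a ha, hσ' a ha, hσ' b hb]
    exact congrArg q (congrArg (fun g : Equiv.Perm X => g x) hab.eq)
  have hzin : z ∈ insert z W := Finset.mem_insert_self _ _
  have hpow : ∀ (m : ℕ) x, (σ' z ^ m) (q x) = q ((σ z ^ m) x) := by
    intro m
    induction m with
    | zero => intro x; simp
    | succ m ih =>
      intro x
      rw [pow_succ, Equiv.Perm.mul_apply, hσ' z hzin, ih, pow_succ, Equiv.Perm.mul_apply]
  have hzn : σ' z ^ n = 1 := by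
    apply Equiv.ext
    intro x
    obtain ⟨x, rfl⟩ := Quotient.exists_rep x
    change (σ' z ^ n) (q x) = q x
    rw [hpow]
    exact (Quotient.sound (s := r) ⟨1, by simp⟩).symm
  let S' : Finset (Quotient r) :=
    (Finset.range n).biUnion fun i => S.image fun s => (σ' z ^ i) (q s)
  have hS' : ∀ i : ZMod n, ∀ s ∈ S, (σ' z ^ i.val) (q s) ∈ S' := by
    intro i s hs
    simp only [S', Finset.mem_biUnion, Finset.mem_range, Finset.mem_image]
    exact ⟨i.val, i.val_lt, s, hs, rfl⟩
  obtain ⟨Y, ι, τ, hfY, hι, hτ, hcompat⟩ := hW (Quotient r) σ' (fun a ha b hb hab =>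
    hcomm' a (Finset.mem_insert_of_mem ha) b (Finset.mem_insert_of_mem hb)
      (hσ a (Finset.mem_insert_of_mem ha) b (Finset.mem_insert_of_mem hb) hab)) S'
  have hne : ∀ w ∈ W, w ≠ z := fun w hw h => hzW (h ▸ hw)
  let post : Equiv.Perm Y → Equiv.Perm (ZMod n → Y) := fun g => Equiv.piCongrRight fun _ => g
  let shift : Equiv.Perm (ZMod n → Y) :=
    Equiv.arrowCongr (Equiv.addRight (1 : ZMod n)).symm (Equiv.refl Y)
  have hps : ∀ g, Commute (post g) shift := fun g => rfl
  refine ⟨ZMod n → Y, fun x i => ι ((σ' z ^ i.val) (q x)),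
    fun v => if v = z then shift else post (τ v), inferInstance, ?_, ?_, ?_⟩
  · intro x hx y hy hxy
    have h0 := congrFun hxy 0
    have hx0 := hS' 0 x hx
    have hy0 := hS' 0 y hy
    have h1 := hι hx0 hy0 h0
    simp only [ZMod.val_zero, pow_zero, Equiv.Perm.one_apply] at h1
    obtain ⟨k, hk⟩ := Quotient.exact h1
    exact hsep x hx y hy k hk
  · intro a ha b hb hab
    rcases Finset.mem_insert.1 ha with rfl | ha2 <;> rcases Finset.mem_insert.1 hb with rfl | hb2
    · exact absurd hab (Γ.loopless.irrefl _)
    · simp only [hne b hb2, if_true, if_false]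
      exact (hps _).symm
    · simp only [hne a ha2, if_true, if_false]
      exact hps _
    · simp only [hne a ha2, hne b hb2, if_false]
      have := (hτ a ha2 b hb2 hab).eq
      apply Equiv.ext
      intro f
      funext i
      exact congrArg (fun g : Equiv.Perm Y => g (f i)) this
  · intro v hv s hs hvs
    have hv0 := hv
    rcases Finset.mem_insert.1 hv with rfl | hv
    · simp only [if_true]
      funext i
      change ι ((σ' v ^ (i + 1).val) (q s)) = ι ((σ' v ^ i.val) (q (σ v s)))
      rw [← hσ' v hzin, ← Equiv.Perm.mul_apply, ← pow_succ, ZMod.val_add,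
        ← pow_eq_pow_mod _ hzn, ZMod.val_one_eq_one_mod, pow_add, pow_add,
        ← pow_eq_pow_mod _ hzn]
    · simp only [hne v hv, if_false]
      funext i
      change τ v (ι ((σ' z ^ i.val) (q s))) = ι ((σ' z ^ i.val) (q (σ v s)))
      have hcm : σ' v ((σ' z ^ i.val) (q s)) = (σ' z ^ i.val) (q (σ v s)) := by
        rw [← hσ' v hv0, ← Equiv.Perm.mul_apply,
          ((hcomm' v hv0 z hzin (hzc v hv0)).pow_right _).eq]
        rfl
      rw [hcompat v hv _ (hS' i s hs) (hcm ▸ hS' i _ hvs), hcm]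

/-- Graph theory: a `P₄`- and `C₄`-free graph has a dominating vertex or is disconnected. -/
theorem mr_graph {V : Type*} [DecidableEq V] (Γ : SimpleGraph V) (hP : ¬ HasInducedP4 Γ)
    (hC : ¬ HasInducedC4 Γ) (W : Finset V) (hne : W.Nonempty) :
    (∃ z ∈ W, ∀ w ∈ W.erase z, Γ.Adj z w) ∨
    ∃ A B : Finset V, A.Nonempty ∧ B.Nonempty ∧ Disjoint A B ∧ A ∪ B = W ∧
      ∀ a ∈ A, ∀ b ∈ B, ¬ Γ.Adj a b := by
  classical
  let N : V → Finset V := fun v => W.filter (Γ.Adj v)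
  obtain ⟨v, hv, hmax⟩ := Finset.exists_max_image W (fun v => (N v).card) hne
  by_cases hdom : ∀ w ∈ W.erase v, Γ.Adj v w
  · exact Or.inl ⟨v, hv, hdom⟩
  right
  push Not at hdom
  obtain ⟨u, hu, huv⟩ := hdom
  have huv' := Finset.mem_erase.1 hu
  refine ⟨insert v (N v), W \ insert v (N v), ⟨v, by simp⟩, ⟨u, ?_⟩, Finset.disjoint_sdiff, ?_, ?_⟩
  · simp [N, huv'.1, huv'.2, huv]
  · apply Finset.union_sdiff_of_subset
    intro w hw
    rcases Finset.mem_insert.1 hw with rfl | hw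
    · exact hv
    · exact (Finset.mem_filter.1 hw).1
  · intro x hx y hy hxy
    simp only [N, Finset.mem_sdiff, Finset.mem_insert, Finset.mem_filter, not_or, not_and] at hx hy
    obtain ⟨hyW, hyv, hny⟩ := hy
    have hvy := hny hyW
    rcases hx with rfl | ⟨hxW, hvx⟩
    · exact hvy hxy
    -- find `w` adjacent to `v` but not to `x`
    have : ∃ w ∈ N v, w ∉ (N x).erase v ∧ w ≠ x := by
      by_contra hcon
      push Not at hcon
      have hsub : N v ⊆ insert x (((N x).erase v).erase y) := by
        intro w hw
        by_cases hwx : w = x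
        · simp [hwx]
        · have h1 : w ∈ (N x).erase v := by
            by_contra h2
            exact hwx (hcon w hw h2)
          refine Finset.mem_insert_of_mem (Finset.mem_erase.2 ⟨?_, h1⟩)
          rintro rfl
          exact hvy (Finset.mem_filter.1 hw).2
      have hvN : v ∈ N x := Finset.mem_filter.2 ⟨hv, hvx.symm⟩
      have hyN : y ∈ (N x).erase v := Finset.mem_erase.2 ⟨hyv, Finset.mem_filter.2 ⟨hyW, hxy⟩⟩
      have c1 := Finset.card_le_card hsub
      have c2 := Finset.card_insert_le x (((N x).erase v).erase y)
      have c3 := Finset.card_erase_of_mem hyN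
      have c4 := Finset.card_erase_of_mem hvN
      have c5 : (N x).card ≤ (N v).card := hmax x hxW
      have c6 : 0 < ((N x).erase v).card := Finset.card_pos.2 ⟨y, hyN⟩
      omega
    obtain ⟨w, hw, hwx', hwx⟩ := this
    obtain ⟨hwW, hvw⟩ := Finset.mem_filter.1 hw
    have hwv : w ≠ v := hvw.ne'
    have hnxw : ¬ Γ.Adj x w := fun h =>
      hwx' (Finset.mem_erase.2 ⟨hwv, Finset.mem_filter.2 ⟨hwW, h⟩⟩)
    have hwy : w ≠ y := fun h => hvy (h ▸ hvw)
    have hinj : Function.Injective ![w, v, x, y] := by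
      intro i j hij
      fin_cases i <;> fin_cases j <;>
        simp_all [hvx.ne, hvx.ne', hxy.ne, hxy.ne', hwx.symm, hwv.symm, hwy.symm, Ne.symm hyv]
    have hnwx : ¬ Γ.Adj w x := fun h => hnxw h.symm
    have hnyv : ¬ Γ.Adj y v := fun h => hvy h.symm
    by_cases hwya : Γ.Adj w y
    · apply hC
      refine ⟨![w, v, x, y], hinj, ?_⟩
      intro i j
      rw [SimpleGraph.cycleGraph_adj]
      fin_cases i <;> fin_cases j <;>
        simp [hvx, hvx.symm, hxy, hxy.symm, hvw, hvw.symm, hwya, hwya.symm, hnwx, hnxw, hnyv, hvy]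
        <;> decide
    · apply hP
      have hnyw : ¬ Γ.Adj y w := fun h => hwya h.symm
      refine ⟨![w, v, x, y], hinj, ?_⟩
      intro i j
      rw [SimpleGraph.pathGraph_adj]
      fin_cases i <;> fin_cases j <;>
        simp [hvx, hvx.symm, hxy, hxy.symm, hvw, hvw.symm, hwya, hnyw, hnwx, hnxw, hnyv, hvy]

theorem mr_comp_all {V : Type uV} (Γ : SimpleGraph V) (hP : ¬ HasInducedP4 Γ)
    (hC : ¬ HasInducedC4 Γ) (W : Finset V) : MRComp Γ W := by
  classical
  induction W using Finset.strongInduction with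
  | H W ih =>
    rcases W.eq_empty_or_nonempty with rfl | hne
    · exact mr_comp_empty Γ
    rcases mr_graph Γ hP hC W hne with ⟨z, hz, hadj⟩ | ⟨A, B, hA, hB, hd, rfl, hno⟩
    · have := mr_comp_cone Γ (W.erase z) z (Finset.notMem_erase z W) hadj
        (ih _ (Finset.erase_ssubset hz))
      rwa [Finset.insert_erase hz] at this
    · refine mr_comp_union Γ A B hd hno (ih A ?_) (ih B ?_)
      · refine Finset.ssubset_iff_subset_ne.2 ⟨Finset.subset_union_left, fun h => ?_⟩
        obtain ⟨b, hb⟩ := hB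
        exact Finset.disjoint_left.1 hd (h ▸ Finset.mem_union_right _ hb) hb
      · refine Finset.ssubset_iff_subset_ne.2 ⟨Finset.subset_union_right, fun h => ?_⟩
        obtain ⟨a, ha⟩ := hA
        exact Finset.disjoint_left.1 hd ha (h ▸ Finset.mem_union_left _ ha)

/-- Each group element only sees a finite part of the action. -/
theorem mr_trace {V : Type uV} {X : Type uV} (σ : V → Equiv.Perm X) (g : FreeGroup V) :
    ∀ x : X, ∃ T : Finset X, ∀ S : Finset X, T ⊆ S →
      ∀ (Y : Type uV) (ι : X → Y) (τ : V → Equiv.Perm Y),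
        (∀ v, ∀ s ∈ S, σ v s ∈ S → τ v (ι s) = ι (σ v s)) →
        FreeGroup.lift τ g (ι x) = ι (FreeGroup.lift σ g x) := by
  classical
  induction g using FreeGroup.induction_on with
  | C1 => intro x; exact ⟨∅, fun S _ Y ι τ _ => by simp⟩
  | of v =>
    intro x
    refine ⟨{x, σ v x}, fun S hS Y ι τ h => ?_⟩
    simp only [FreeGroup.lift_apply_of]
    exact h v x (hS (by simp)) (hS (by simp))
  | inv_of v _ =>
    intro x
    refine ⟨{x, (σ v)⁻¹ x}, fun S hS Y ι τ h => ?_⟩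
    simp only [map_inv, FreeGroup.lift_apply_of]
    rw [Equiv.Perm.inv_eq_iff_eq, h v _ (hS (by simp)) (hS (by simp))]
    simp
  | mul g k hg hk =>
    intro x
    obtain ⟨T1, h1⟩ := hk x
    obtain ⟨T2, h2⟩ := hg (FreeGroup.lift σ k x)
    refine ⟨T1 ∪ T2, fun S hS Y ι τ h => ?_⟩
    rw [map_mul, map_mul, Equiv.Perm.mul_apply, Equiv.Perm.mul_apply,
      h1 S (Finset.union_subset_left hS) Y ι τ h, h2 S (Finset.union_subset_right hS) Y ι τ h]

theorem mr_separable {V : Type uV} [Fintype V] (Γ : SimpleGraph V)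
    (hW : MRComp Γ Finset.univ) : SubgroupSeparable (RAAG Γ) := by
  classical
  intro H hH
  obtain ⟨l, hl⟩ := hH
  refine ⟨{K | K.FiniteIndex ∧ H ≤ K}, fun K hK => hK.1, le_antisymm (le_sInf fun K hK => hK.2) ?_⟩
  intro g hg
  by_contra hgH
  rw [Subgroup.mem_sInf] at hg
  let X := RAAG Γ ⧸ H
  let x0 : X := ((1 : RAAG Γ) : RAAG Γ ⧸ H)
  let ρ : RAAG Γ →* Equiv.Perm X := MulAction.toPermHom _ _
  let σ : V → Equiv.Perm X := fun v => ρ (PresentedGroup.of v)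
  have hlift : ∀ w : FreeGroup V, FreeGroup.lift σ w = ρ (PresentedGroup.mk _ w) := by
    intro w
    have : FreeGroup.lift σ = ρ.comp (PresentedGroup.mk (raagRels Γ)) := by
      ext v : 1
      simp [σ, PresentedGroup.of]
    rw [this]; rfl
  choose T hT using fun w => mr_trace σ w x0
  choose wd hwd using PresentedGroup.mk_surjective (raagRels Γ)
  let S : Finset X := insert x0 (insert (ρ g x0) (T (wd g) ∪ l.biUnion fun k => T (wd k)))
  obtain ⟨Y, ι, τ, hfin, hι, hτ, hc⟩ := hW X σ
    (fun a _ b _ hab => (mr_commute hab).map ρ) S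
  obtain ⟨θ, hθ⟩ := mr_lift (Γ := Γ) τ
    (fun a b hab => hτ a (Finset.mem_univ _) b (Finset.mem_univ _) hab)
  have hθlift : ∀ k, FreeGroup.lift τ (wd k) = θ k := by
    intro k
    have : FreeGroup.lift τ = θ.comp (PresentedGroup.mk (raagRels Γ)) := by
      ext v : 1
      have := hθ v
      simpa [PresentedGroup.of] using this.symm
    rw [this]
    exact congrArg θ (hwd k)
  have key : ∀ k, T (wd k) ⊆ S → θ k (ι x0) = ι (ρ k x0) := by
    intro k hk
    have := hT (wd k) S hk Y ι τ (fun v => hc v (Finset.mem_univ _))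
    rwa [hθlift, hlift, hwd] at this
  let K : Subgroup (RAAG Γ) := (MulAction.stabilizer (Equiv.Perm Y) (ι x0)).comap θ
  have hKfin : K.FiniteIndex := by
    have : θ.ker.FiniteIndex := inferInstance
    exact Subgroup.finiteIndex_of_le (H := θ.ker) (MonoidHom.ker_le_comap θ _)
  have hHK : H ≤ K := by
    rw [← hl, Subgroup.closure_le]
    intro k hk
    change θ k (ι x0) = ι x0
    rw [key k ?_]
    · have hkH : k ∈ H := hl ▸ Subgroup.subset_closure hk
      congr 1
      change ((k * 1 : RAAG Γ) : RAAG Γ ⧸ H) = ((1 : RAAG Γ) : RAAG Γ ⧸ H)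
      rw [eq_comm, QuotientGroup.eq]
      simpa using hkH
    · intro t ht
      refine Finset.mem_insert_of_mem (Finset.mem_insert_of_mem (Finset.mem_union_right _ ?_))
      exact Finset.mem_biUnion.2 ⟨k, hk, ht⟩
  have hgK : θ g (ι x0) = ι x0 := hg K ⟨hKfin, hHK⟩
  rw [key g ?_] at hgK
  · have h1 : ρ g x0 = x0 := hι (by simp [S]) (by simp [S]) hgK
    change ((g * 1 : RAAG Γ) : RAAG Γ ⧸ H) = ((1 : RAAG Γ) : RAAG Γ ⧸ H) at h1
    rw [eq_comm, QuotientGroup.eq] at h1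
    exact hgH (by simpa using h1)
  · intro t ht
    exact Finset.mem_insert_of_mem (Finset.mem_insert_of_mem (Finset.mem_union_left _ ht))

/-- Metaftsis–Raptis. A right-angled Artin group `A(Γ)` is subgroup
separable if and only if `Γ` contains neither `P₄` nor `C₄` as an induced subgraph. -/
theorem stmt_15 {V : Type*} [Fintype V] (Γ : SimpleGraph V) :
    SubgroupSeparable (RAAG Γ) ↔ ¬ HasInducedP4 Γ ∧ ¬ HasInducedC4 Γ := by
  constructor
  · intro h
    exact ⟨mr_not_P4 h, mr_not_C4 h⟩
  · rintro ⟨hP, hC⟩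
    exact mr_separable Γ (mr_comp_all Γ hP hC _)
end
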